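/- Let S_1, …, S_n be a subchain, i.e. pairwise compatible D-admissible subsets of [±n] ordered so that |S_1| ≤ … ≤ |S_n|. Let λ be the signed Young diagram with λ_i = |S_{n+1−i}|, where each row of length n is labeled + if the corresponding set contains an even number of negative integers and − otherwise; let m be the number of rows of length n and m_+, m_− the numbers of such rows labeled +, − respectively; let s, a_r, b_r, c_r, y_r be the corner data of λ. Define ỹ_1 = 2^{(n−λ_1−1)(1−m)}·C(a_1,c_1)·C(b_1,c_1) if m ≤ 1; ỹ_1 = −C(b_1−1, c_1−1) if m ≥ 2 and m_+·m_− ≠ 0; and ỹ_1 = (2^{a_1}−a_1−1)·C(b_1,c_1) + C(b_1−1,c_1) if m ≥ 2 and m_+·m_− = 0. Then in R^D_n one has τ_{S_1}⋯τ_{S_n} = (−1)^{n+s}·ỹ_1·y_2⋯y_s · τ_{{1}}·τ_{{1,2}}⋯τ_{{1,…,n−2}}·τ_{{1,…,n−1,n}}·τ_{{1,…,n−1,−n}}. (This is the algebraic form of the type D_n intersection-number formula ⟨τ_{S_1}⋯τ_{S_n}, μ_X⟩ = (−1)^{n+s} ỹ_1 y_2⋯y_s.) -/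

import Mathlib

open MvPolynomial

/-- The set `[±n]`, realized as `Fin n × Bool`: `(k, true) ↔ k+1` and `(k, false) ↔ −(k+1)`. -/
abbrev PM (n : ℕ) := Fin n × Bool

/-- Negation on `[±n]`. -/
def negPM {n : ℕ} (p : PM n) : PM n := (p.1, !p.2)

/-- A subset `S ⊆ [±n]` is D-admissible if it is nonempty, contains no pair `{i, −i}`,
and `|S| ≠ n − 1`. -/
def DAdm (n : ℕ) (S : Finset (PM n)) : Prop :=
  S.Nonempty ∧ (∀ p ∈ S, negPM p ∉ S) ∧ S.card ≠ n - 1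

instance (n : ℕ) (S : Finset (PM n)) : Decidable (DAdm n S) := by unfold DAdm; infer_instance

/-- Two D-admissible sets are compatible if `S ⊆ T`, or `T ⊆ S`, or `|S| = |T| = n` and
`|S ∩ T| = n − 1`. -/
def Compat (n : ℕ) (S T : Finset (PM n)) : Prop :=
  S ⊆ T ∨ T ⊆ S ∨ (S.card = n ∧ T.card = n ∧ (S ∩ T).card = n - 1)

instance (n : ℕ) (S T : Finset (PM n)) : Decidable (Compat n S T) := by
  unfold Compat; infer_instance

/-- Index type of the variables: the D-admissible subsets of `[±n]`. -/
abbrev IdxD (n : ℕ) := {S : Finset (PM n) // DAdm n S}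

/-- `ε_k(S) = 1` if `k ∈ S`, `−1` if `−k ∈ S`, and `0` otherwise. -/
def eps (n : ℕ) (k : Fin n) (S : Finset (PM n)) : ℤ :=
  if (k, true) ∈ S then 1 else if (k, false) ∈ S then -1 else 0

/-- Generators of the defining ideal of `R^D_n`: (i) products `τ_S τ_T` for incompatible `S, T`;
(ii) for `k ≠ l` and each sign `e = ±1`,
`Σ_{|S|≤n−2} (ε_k(S) − e·ε_l(S)) τ_S + Σ_{|S|=n} ((ε_k(S) − e·ε_l(S))/2) τ_S`. -/
def relD (n : ℕ) : Set (MvPolynomial (IdxD n) ℤ) :=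
  {p | ∃ S T : IdxD n, ¬ Compat n S.1 T.1 ∧ p = X S * X T} ∪
  {p | ∃ k l : Fin n, ∃ e : ℤ, (e = 1 ∨ e = -1) ∧ k ≠ l ∧ p =
      (∑ S : IdxD n, if S.1.card ≤ n - 2 then C (eps n k S.1 - e * eps n l S.1) * X S else 0) +
      (∑ S : IdxD n, if S.1.card = n then C ((eps n k S.1 - e * eps n l S.1) / 2) * X S else 0)}

/-- The ring `R^D_n`. -/
abbrev RD (n : ℕ) := MvPolynomial (IdxD n) ℤ ⧸ Ideal.span (relD n)

/-- The class `τ_S ∈ R^D_n` of a D-admissible subset `S ⊆ [±n]`. -/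
noncomputable def tauD (n : ℕ) (S : Finset (PM n)) : RD n :=
  if h : DAdm n S then Ideal.Quotient.mk _ (X (⟨S, h⟩ : IdxD n)) else 1

/-- The subset `{1,…,i}` of `[±n]`. -/
def initSegD (n i : ℕ) : Finset (PM n) :=
  Finset.univ.filter (fun p : PM n => p.2 = true ∧ (p.1 : ℕ) < i)

/-- The subset `[n]_+ = {1,…,n−1,n}` of `[±n]`. -/
def fullPlus (n : ℕ) : Finset (PM n) :=
  Finset.univ.filter (fun p : PM n => p.2 = true)

/-- The subset `[n]_− = {1,…,n−1,−n}` of `[±n]`. -/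
def fullMinus (n : ℕ) : Finset (PM n) :=
  Finset.univ.filter (fun p : PM n =>
    (p.2 = true ∧ (p.1 : ℕ) < n - 1) ∨ (p.2 = false ∧ (p.1 : ℕ) = n - 1))

/-- The class of a point: `τ_{{1}} ⋯ τ_{{1,…,n−2}} · τ_{[n]_+} · τ_{[n]_−}`. -/
noncomputable def ptD (n : ℕ) : RD n :=
  (∏ i ∈ Finset.Icc 1 (n - 2), tauD n (initSegD n i)) * tauD n (fullPlus n) *
    tauD n (fullMinus n)

/-- The number of negative entries of `S ⊆ [±n]`. -/
def negCount {n : ℕ} (S : Finset (PM n)) : ℕ := (S.filter (fun p => p.2 = false)).card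


/-- `λ_i` extended by `0` for `i > n`. -/
def lamE (n : ℕ) (lam : ℕ → ℕ) (i : ℕ) : ℕ := if i ≤ n then lam i else 0

/-- The sorted list `i_1 < … < i_s` of lower-right corners of `λ`. -/
def cornerL (n : ℕ) (lam : ℕ → ℕ) : List ℕ :=
  ((Finset.Icc 1 n).filter (fun i => lamE n lam (i + 1) < lamE n lam i)).sort (· ≤ ·)

/-- The number `s` of lower-right corners of `λ`. -/
def sC (n : ℕ) (lam : ℕ → ℕ) : ℕ := (cornerL n lam).length

/-- `i_r` (with `i_0 = 0`; out-of-range indices default to `n+1`, where `λ` vanishes). -/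
def iC (n : ℕ) (lam : ℕ → ℕ) (r : ℕ) : ℕ :=
  if r = 0 then 0 else (cornerL n lam).getD (r - 1) (n + 1)

/-- `a_r = i_r − i_{r−1} − 1`. -/
def aC (n : ℕ) (lam : ℕ → ℕ) (r : ℕ) : ℤ := (iC n lam r : ℤ) - iC n lam (r - 1) - 1

/-- `b_r = λ_{i_r} − λ_{i_{r+1}} − 1` (with `λ_{i_{s+1}} = 0`). -/
def bC (n : ℕ) (lam : ℕ → ℕ) (r : ℕ) : ℤ :=
  (lamE n lam (iC n lam r) : ℤ) - lamE n lam (iC n lam (r + 1)) - 1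

/-- `c_r = λ_{i_r} + i_r − n − 1`. -/
def cC (n : ℕ) (lam : ℕ → ℕ) (r : ℕ) : ℤ :=
  (lamE n lam (iC n lam r) : ℤ) + iC n lam r - n - 1

/-- Binomial coefficient `C(x,y)` with `C(x,y) = 0` unless `0 ≤ y ≤ x`. -/
def Cb (x y : ℤ) : ℤ := if 0 ≤ y ∧ y ≤ x then (x.toNat.choose y.toNat : ℤ) else 0

/-- `y_r = C(a_r, c_r) · C(b_r, c_r)`. -/
def yC (n : ℕ) (lam : ℕ → ℕ) (r : ℕ) : ℤ :=
  Cb (aC n lam r) (cC n lam r) * Cb (bC n lam r) (cC n lam r)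

/-- `I(λ) = (−1)^{n+s} y_1 ⋯ y_s`. -/
def IY (n : ℕ) (lam : ℕ → ℕ) : ℤ :=
  (-1) ^ (n + sC n lam) * ∏ r ∈ Finset.Icc 1 (sC n lam), yC n lam r

/-- The modified first factor `ỹ_1` of the type `D_n` intersection formula, depending on the
corner data of `λ` and the counts `m = m_+ + m_−` of rows of length `n` labeled `+` resp. `−`. -/
def tyOne (n : ℕ) (lam : ℕ → ℕ) (m mP mM : ℕ) : ℤ :=
  if m ≤ 1 then
    2 ^ ((n - lam 1 - 1) * (1 - m)) * Cb (aC n lam 1) (cC n lam 1) * Cb (bC n lam 1) (cC n lam 1)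
  else if mP ≠ 0 ∧ mM ≠ 0 then
    - Cb (bC n lam 1 - 1) (cC n lam 1 - 1)
  else
    (2 ^ (aC n lam 1).toNat - aC n lam 1 - 1) * Cb (bC n lam 1) (cC n lam 1) +
      Cb (bC n lam 1 - 1) (cC n lam 1)

/-- The class `ψ⁻` of the interval `(T, U)`, computed with the element `p`. -/
def psiLow {α R : Type*} [DecidableEq α] [CommRing R] (x : Finset α → R) (T U : Finset α) (p : α) :
    R := ∑ A ∈ (Finset.Ioo T U).filter (fun A => p ∈ A), x A

/-- The class `ψ⁺` of the interval `(T, U)`, computed with the element `q`. -/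
def psiUp {α R : Type*} [DecidableEq α] [CommRing R] (x : Finset α → R) (T U : Finset α) (q : α) :
    R := ∑ A ∈ (Finset.Ioo T U).filter (fun A => q ∉ A), x A

/-- After multiplication by `w`, the family `x` satisfies on the interval `(T, U)` the relations
of the cohomology ring of a permutohedral variety. -/
structure PermRel {α R : Type*} [DecidableEq α] [CommRing R] (x : Finset α → R) (w : R)
    (T U : Finset α) : Prop where
  mul_eq_zero : ∀ A ∈ Finset.Ioo T U, ∀ B ∈ Finset.Ioo T U, ¬ A ⊆ B → ¬ B ⊆ A →
    w * x A * x B = 0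
  low_congr : ∀ p ∈ U \ T, ∀ q ∈ U \ T, w * psiLow x T U p = w * psiLow x T U q

theorem mul_pow_congr {R : Type*} [CommRing R] {w a b : R} (h : w * a = w * b) (k : ℕ) :
    w * a ^ k = w * b ^ k := by
  induction k with
  | zero => simp
  | succ k ih => linear_combination b * ih + a ^ k * h

section Perm

variable {α R : Type*} [DecidableEq α] [CommRing R] {x : Finset α → R} {w : R}
  {S T U : Finset α} {p q : α}

theorem card_sdiff_add_of_mem_Ioo (hS : S ∈ Finset.Ioo T U) :
    (U \ S).card + (S \ T).card = (U \ T).card ∧ 0 < (U \ S).card ∧ 0 < (S \ T).card := by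
  rw [Finset.mem_Ioo] at hS
  have h1 := Finset.card_lt_card hS.1
  have h2 := Finset.card_lt_card hS.2
  rw [Finset.card_sdiff_of_subset hS.1.1, Finset.card_sdiff_of_subset hS.2.1,
    Finset.card_sdiff_of_subset (hS.1.1.trans hS.2.1)]
  omega

theorem PermRel.up_congr (h : PermRel x w T U) (hp : p ∈ U \ T) (hq : q ∈ U \ T) :
    w * psiUp x T U p = w * psiUp x T U q := by
  have key (r : α) : psiLow x T U r + psiUp x T U r = ∑ A ∈ Finset.Ioo T U, x A :=
    Finset.sum_filter_add_sum_filter_not _ _ _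
  linear_combination w * key p - w * key q - h.low_congr p hp q hq

theorem PermRel.low_restrict (h : PermRel x w T U) (hS : S ∈ Finset.Ioo T U) (hp : p ∈ U \ S) :
    w * x S * psiLow x T U p = w * x S * psiLow x S U p := by
  have hS' := Finset.mem_Ioo.1 hS
  unfold psiLow
  rw [Finset.mul_sum, Finset.mul_sum]
  symm
  apply Finset.sum_subset
  · intro A hA
    simp only [Finset.mem_filter, Finset.mem_Ioo] at hA ⊢
    exact ⟨⟨hS'.1.trans hA.1.1, hA.1.2⟩, hA.2⟩
  · intro A hA hA'
    simp only [Finset.mem_filter, Finset.mem_Ioo, not_and] at hA hA'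
    refine h.mul_eq_zero S hS A (Finset.mem_Ioo.2 hA.1) (fun hSA => ?_) (fun hAS => ?_)
    · refine hA' ⟨lt_of_le_of_ne hSA ?_, hA.1.2⟩ hA.2
      rintro rfl
      exact (Finset.mem_sdiff.1 hp).2 hA.2
    · exact (Finset.mem_sdiff.1 hp).2 (hAS hA.2)

theorem PermRel.up_restrict (h : PermRel x w T U) (hS : S ∈ Finset.Ioo T U) (hp : p ∈ S \ T) :
    w * x S * psiUp x T U p = w * x S * psiUp x T S p := by
  have hS' := Finset.mem_Ioo.1 hS
  unfold psiUp
  rw [Finset.mul_sum, Finset.mul_sum]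
  symm
  apply Finset.sum_subset
  · intro A hA
    simp only [Finset.mem_filter, Finset.mem_Ioo] at hA ⊢
    exact ⟨⟨hA.1.1, hA.1.2.trans hS'.2⟩, hA.2⟩
  · intro A hA hA'
    simp only [Finset.mem_filter, Finset.mem_Ioo, not_and] at hA hA'
    refine h.mul_eq_zero S hS A (Finset.mem_Ioo.2 hA.1) (fun hSA => ?_) (fun hAS => ?_)
    · exact hA.2 (hSA (Finset.mem_sdiff.1 hp).1)
    · refine hA' ⟨hA.1.1, lt_of_le_of_ne hAS ?_⟩ hA.2
      rintro rfl
      exact hA.2 (Finset.mem_sdiff.1 hp).1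

theorem PermRel.upper (h : PermRel x w T U) (hS : S ∈ Finset.Ioo T U) :
    PermRel x (w * x S) S U where
  mul_eq_zero A hA B hB hAB hBA := by
    have hS' := Finset.mem_Ioo.1 hS
    rw [Finset.mem_Ioo] at hA hB
    linear_combination x S * h.mul_eq_zero A (Finset.mem_Ioo.2 ⟨hS'.1.trans hA.1, hA.2⟩) B
      (Finset.mem_Ioo.2 ⟨hS'.1.trans hB.1, hB.2⟩) hAB hBA
  low_congr p hp q hq := by
    have hTS := Finset.sdiff_subset_sdiff (Finset.Subset.refl U) (Finset.mem_Ioo.1 hS).1.1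
    rw [← h.low_restrict hS hp, ← h.low_restrict hS hq]
    linear_combination x S * h.low_congr p (hTS hp) q (hTS hq)

theorem PermRel.lower (h : PermRel x w T U) (hS : S ∈ Finset.Ioo T U) :
    PermRel x (w * x S) T S where
  mul_eq_zero A hA B hB hAB hBA := by
    have hS' := Finset.mem_Ioo.1 hS
    rw [Finset.mem_Ioo] at hA hB
    linear_combination x S * h.mul_eq_zero A (Finset.mem_Ioo.2 ⟨hA.1, hA.2.trans hS'.2⟩) B
      (Finset.mem_Ioo.2 ⟨hB.1, hB.2.trans hS'.2⟩) hAB hBA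
  low_congr p hp q hq := by
    have hTS := Finset.sdiff_subset_sdiff (Finset.mem_Ioo.1 hS).2.1 (Finset.Subset.refl T)
    have key (r : α) : psiLow x T S r + psiUp x T S r = ∑ A ∈ Finset.Ioo T S, x A :=
      Finset.sum_filter_add_sum_filter_not _ _ _
    linear_combination w * x S * key p - w * x S * key q + h.up_restrict hS hp
      - h.up_restrict hS hq - x S * h.up_congr (hTS hp) (hTS hq)

theorem PermRel.low_pow_restrict (h : PermRel x w T U) (hS : S ∈ Finset.Ioo T U)
    (hp : p ∈ U \ T) (hq : q ∈ U \ S) (k : ℕ) :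
    w * x S * psiLow x T U p ^ k = w * x S * psiLow x S U q ^ k := by
  have hTS := Finset.sdiff_subset_sdiff (Finset.Subset.refl U) (Finset.mem_Ioo.1 hS).1.1
  apply mul_pow_congr
  rw [← h.low_restrict hS hq]
  linear_combination x S * h.low_congr p hp q (hTS hq)

theorem PermRel.up_pow_restrict (h : PermRel x w T U) (hS : S ∈ Finset.Ioo T U)
    (hp : p ∈ U \ T) (hq : q ∈ S \ T) (k : ℕ) :
    w * x S * psiUp x T U p ^ k = w * x S * psiUp x T S q ^ k := by
  have hTS := Finset.sdiff_subset_sdiff (Finset.mem_Ioo.1 hS).2.1 (Finset.Subset.refl T)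
  apply mul_pow_congr
  rw [← h.up_restrict hS hq]
  linear_combination x S * h.up_congr hp (hTS hq)

theorem PermRel.low_pow_mul_up_pow_eq_zero (h : PermRel x w T U) (hp : p ∈ U \ T)
    (hq : q ∈ U \ T) {i j : ℕ} (hij : (U \ T).card ≤ i + j) :
    w * psiLow x T U p ^ i * psiUp x T U q ^ j = 0 := by
  induction hg : (U \ T).card using Nat.strong_induction_on generalizing w T U p q i j with
  | _ g ih =>
  have step {S : Finset α} (hS : S ∈ Finset.Ioo T U) {i j : ℕ} (hij : g ≤ i + j + 1) :
      w * x S * psiLow x T U p ^ i * psiUp x T U q ^ j = 0 := by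
    obtain ⟨hc, hu, hl⟩ := card_sdiff_add_of_mem_Ioo hS
    obtain ⟨p', hp'⟩ := Finset.card_pos.1 hu
    obtain ⟨q', hq'⟩ := Finset.card_pos.1 hl
    rcases le_or_gt (U \ S).card i with hi | hi
    · have := ih _ (by omega) (h.upper hS) hp' hp' (i := i) (j := 0) (by omega) rfl
      rw [h.low_pow_restrict hS hp hp']
      linear_combination psiUp x T U q ^ j * this
    · have := ih _ (by omega) (h.lower hS) hq' hq' (i := 0) (j := j) (by omega) rfl
      have h2 := h.up_pow_restrict hS hq hq' j
      linear_combination psiLow x T U p ^ i * this + psiLow x T U p ^ i * h2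
  have hpos : 0 < (U \ T).card := Finset.card_pos.2 ⟨p, hp⟩
  rcases j with _ | j
  · rcases i with _ | i
    · omega
    · have : w * psiLow x T U p ^ (i + 1) * psiUp x T U q ^ 0 =
          ∑ A ∈ (Finset.Ioo T U).filter (fun A => p ∈ A),
            w * x A * psiLow x T U p ^ i * psiUp x T U q ^ 0 := by
        rw [← Finset.sum_mul, ← Finset.sum_mul, ← Finset.mul_sum, ← psiLow]
        ring
      rw [this]
      exact Finset.sum_eq_zero fun A hA => step (Finset.mem_filter.1 hA).1 (by omega)
  · have : w * psiLow x T U p ^ i * psiUp x T U q ^ (j + 1) =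
        ∑ A ∈ (Finset.Ioo T U).filter (fun A => q ∉ A),
          w * x A * psiLow x T U p ^ i * psiUp x T U q ^ j := by
      rw [← Finset.sum_mul, ← Finset.sum_mul, ← Finset.mul_sum, ← psiUp]
      ring
    rw [this]
    exact Finset.sum_eq_zero fun A hA => step (Finset.mem_filter.1 hA).1 (by omega)

theorem PermRel.low_pow_atom (h : PermRel x w T U) (hS : insert p T ∈ Finset.Ioo T U)
    (hp : p ∈ U \ T) (hq : q ∈ U \ insert p T) :
    w * psiLow x T U p ^ ((U \ T).card - 1) =
      w * x (insert p T) * psiLow x (insert p T) U q ^ ((U \ insert p T).card - 1) := by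
  have hp' := Finset.mem_sdiff.1 hp
  have h1 : (insert p T \ T).card = 1 := by
    rw [Finset.insert_sdiff_of_notMem _ hp'.2]
    simp
  obtain ⟨hc, hu, hl⟩ := card_sdiff_add_of_mem_Ioo hS
  obtain ⟨k, hk⟩ : ∃ k, (U \ T).card - 1 = k + 1 := ⟨(U \ T).card - 2, by omega⟩
  have hk' : (U \ insert p T).card - 1 = k := by omega
  rw [hk, hk', ← h.low_pow_restrict hS hp hq]
  have : w * psiLow x T U p ^ (k + 1) =
      ∑ A ∈ (Finset.Ioo T U).filter (fun A => p ∈ A), w * x A * psiLow x T U p ^ k := by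
    rw [← Finset.sum_mul, ← Finset.mul_sum, ← psiLow]
    ring
  rw [this]
  apply Finset.sum_eq_single_of_mem
  · simp [hS]
  · intro A hA hne
    obtain ⟨hA1, hA2⟩ := Finset.mem_filter.1 hA
    obtain ⟨hc', hu', hl'⟩ := card_sdiff_add_of_mem_Ioo hA1
    obtain ⟨p', hp''⟩ := Finset.card_pos.1 hu'
    have hsub : insert p T ⊂ A := lt_of_le_of_ne
      (Finset.insert_subset hA2 (Finset.mem_Ioo.1 hA1).1.1) (Ne.symm hne)
    have hcard : (insert p T \ T).card < (A \ T).card :=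
      Finset.card_lt_card (sdiff_lt_sdiff_right hsub (Finset.subset_insert p T))
    rw [h.low_pow_restrict hA1 hp hp'']
    have := (h.upper hA1).low_pow_mul_up_pow_eq_zero hp'' hp'' (i := k) (j := 0) (by omega)
    simpa using this

theorem PermRel.low_pow_trans (h : PermRel x w T U) (hS : S ∈ Finset.Ioo T U) {p p' p'' : α}
    (hp : p ∈ S \ T) (hp' : p' ∈ U \ S) (hp'' : p'' ∈ U \ T) :
    w * x S * psiLow x T S p ^ ((S \ T).card - 1) * psiLow x S U p' ^ ((U \ S).card - 1) =
      w * psiLow x T U p'' ^ ((U \ T).card - 1) := by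
  induction hg : (S \ T).card using Nat.strong_induction_on generalizing w T p p'' with
  | _ g ih =>
  have hS' := Finset.mem_Ioo.1 hS
  have hpU : p ∈ U \ T := Finset.sdiff_subset_sdiff hS'.2.1 (Finset.Subset.refl T) hp
  have hpT := (Finset.mem_sdiff.1 hp).2
  rw [mul_pow_congr (h.low_congr _ hp'' _ hpU)]
  have hsub : insert p T ⊆ S := Finset.insert_subset (Finset.mem_sdiff.1 hp).1 hS'.1.1
  rcases eq_or_ne (insert p T) S with rfl | hne
  · have h1 : (insert p T \ T).card = 1 := by
      rw [Finset.insert_sdiff_of_notMem _ hpT]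
      simp
    rw [h.low_pow_atom hS hpU hp', ← hg, h1]
    simp
  · have hTI : T ⊂ insert p T := Finset.ssubset_insert hpT
    have hIS : insert p T ⊂ S := lt_of_le_of_ne hsub hne
    have hI : insert p T ∈ Finset.Ioo T U := Finset.mem_Ioo.2 ⟨hTI, hIS.trans hS'.2⟩
    have hI' : insert p T ∈ Finset.Ioo T S := Finset.mem_Ioo.2 ⟨hTI, hIS⟩
    obtain ⟨hc, hu, hl⟩ := card_sdiff_add_of_mem_Ioo hI'
    obtain ⟨q, hq⟩ := Finset.card_pos.1 hu
    have hqU : q ∈ U \ insert p T := Finset.sdiff_subset_sdiff hS'.2.1 (Finset.Subset.refl _) hq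
    have h1 := (h.lower hS).low_pow_atom hI' hp hq
    have h2 := ih _ (by omega) (h.upper hI) (Finset.mem_Ioo.2 ⟨hIS, hS'.2⟩) hq hqU rfl
    rw [← hg, h1, h.low_pow_atom hI hpU hqU, ← h2]
    ring

theorem card_filter_Ioo_card (hTU : T ⊂ U) (hq : q ∈ U \ T) {j : ℕ} (hj : 0 < j) :
    ((Finset.Ioo T U).filter (fun A => q ∉ A ∧ (A \ T).card = j)).card =
      ((U \ T).card - 1).choose j := by
  obtain ⟨hqU, hqT⟩ := Finset.mem_sdiff.1 hq
  rw [← Finset.card_erase_of_mem hq, ← Finset.card_powersetCard]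
  refine Finset.card_nbij' (fun A => A \ T) (fun B => B ∪ T) ?_ ?_ ?_ ?_
  · intro A hA
    simp only [Finset.coe_filter, Finset.mem_Ioo, Set.mem_ofPred_eq] at hA
    simp only [Finset.mem_coe, Finset.mem_powersetCard]
    refine ⟨fun a ha => ?_, hA.2.2⟩
    rw [Finset.mem_sdiff] at ha
    rw [Finset.mem_erase, Finset.mem_sdiff]
    refine ⟨?_, hA.1.2.1 ha.1, ha.2⟩
    rintro rfl
    exact hA.2.1 ha.1
  · intro B hB
    simp only [Finset.mem_coe, Finset.mem_powersetCard] at hB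
    have hdis : Disjoint B T := by
      rw [Finset.disjoint_left]
      intro a ha
      exact (Finset.mem_sdiff.1 (Finset.mem_of_mem_erase (hB.1 ha))).2
    have hqB : q ∉ B ∪ T := by
      rw [Finset.mem_union, not_or]
      exact ⟨fun hqB => (Finset.mem_erase.1 (hB.1 hqB)).1 rfl, hqT⟩
    have hsd : (B ∪ T) \ T = B := by
      rw [Finset.union_sdiff_right, Finset.sdiff_eq_self_of_disjoint hdis]
    simp only [Finset.coe_filter, Finset.mem_Ioo, Set.mem_ofPred_eq, hsd]
    refine ⟨⟨?_, ?_⟩, hqB, hB.2⟩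
    · refine lt_of_le_of_ne Finset.subset_union_right fun he => ?_
      rw [← he] at hsd
      simp only [sdiff_self, Finset.bot_eq_empty] at hsd
      rw [← hsd] at hB
      simp at hB
      omega
    · refine lt_of_le_of_ne (Finset.union_subset (fun a ha => ?_) hTU.1) fun he => ?_
      · exact (Finset.mem_sdiff.1 (Finset.mem_of_mem_erase (hB.1 ha))).1
      · exact hqB (he ▸ hqU)
  · intro A hA
    simp only [Finset.coe_filter, Finset.mem_Ioo, Set.mem_ofPred_eq] at hA
    exact Finset.sdiff_union_of_subset hA.1.1.1
  · intro B hB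
    simp only [Finset.mem_coe, Finset.mem_powersetCard] at hB
    have hdis : Disjoint B T := by
      rw [Finset.disjoint_left]
      intro a ha
      exact (Finset.mem_sdiff.1 (Finset.mem_of_mem_erase (hB.1 ha))).2
    change (B ∪ T) \ T = B
    rw [Finset.union_sdiff_right, Finset.sdiff_eq_self_of_disjoint hdis]

theorem PermRel.low_pow_mul_up_pow (h : PermRel x w T U) (hTU : T ⊂ U) (hp : p ∈ U \ T)
    (hq : q ∈ U \ T) {i j : ℕ} (hij : i + j + 1 = (U \ T).card) :
    w * psiLow x T U p ^ i * psiUp x T U q ^ j =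
      ((U \ T).card - 1).choose i * (w * psiLow x T U p ^ ((U \ T).card - 1)) := by
  induction hg : (U \ T).card using Nat.strong_induction_on generalizing w T U p q i j with
  | _ g ih =>
  rcases j with _ | j
  · have : g - 1 = i := by omega
    rw [this]
    simp
  have : w * psiLow x T U p ^ i * psiUp x T U q ^ (j + 1) =
      ∑ A ∈ (Finset.Ioo T U).filter (fun A => q ∉ A),
        w * x A * psiLow x T U p ^ i * psiUp x T U q ^ j := by
    rw [← Finset.sum_mul, ← Finset.sum_mul, ← Finset.mul_sum, ← psiUp]
    ring
  rw [this]
  have key : ∀ A ∈ (Finset.Ioo T U).filter (fun A => q ∉ A),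
      w * x A * psiLow x T U p ^ i * psiUp x T U q ^ j =
        if (A \ T).card = j + 1 then w * psiLow x T U p ^ (g - 1) else 0 := by
    intro A hA
    have hA' := (Finset.mem_filter.1 hA).1
    obtain ⟨hc, hu, hl⟩ := card_sdiff_add_of_mem_Ioo hA'
    obtain ⟨p', hp'⟩ := Finset.card_pos.1 hu
    obtain ⟨q', hq'⟩ := Finset.card_pos.1 hl
    have e1 := h.low_pow_restrict hA' hp hp' i
    have e2 := h.up_pow_restrict hA' hq hq' j
    rcases lt_trichotomy (A \ T).card (j + 1) with hlt | heq | hgt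
    · rw [if_neg (by omega)]
      have := (h.lower hA').low_pow_mul_up_pow_eq_zero hq' hq' (i := 0) (j := j) (by omega)
      linear_combination psiLow x T U p ^ i * e2 + psiLow x T U p ^ i * this
    · rw [if_pos heq]
      have h1 := ih _ (by omega) (h.lower hA') (Finset.mem_Ioo.1 hA').1 hq' hq'
        (i := 0) (j := j) (by omega) rfl
      have h2 := h.low_pow_trans hA' hq' hp' hp
      have hi : (U \ A).card - 1 = i := by omega
      rw [hi, hg] at h2
      rw [Nat.choose_zero_right, Nat.cast_one] at h1
      linear_combination psiLow x T U p ^ i * e2 + psiLow x T U p ^ i * h1 +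
        psiLow x T A q' ^ ((A \ T).card - 1) * e1 + h2
    · rw [if_neg (by omega)]
      have := (h.upper hA').low_pow_mul_up_pow_eq_zero hp' hp' (i := i) (j := 0) (by omega)
      linear_combination psiUp x T U q ^ j * e1 + psiUp x T U q ^ j * this
  rw [Finset.sum_congr rfl key, ← Finset.sum_filter, Finset.filter_filter, Finset.sum_const,
    card_filter_Ioo_card hTU hq (Nat.succ_pos j), nsmul_eq_mul, hg]
  congr 2
  rw [← Nat.choose_symm_of_eq_add]
  omega

end Perm

/-- The coefficient of `τ_S` in the relation attached to the signed indices `p` and `q`. -/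
def sgnPM {n : ℕ} (p : PM n) (S : Finset (PM n)) : ℤ :=
  if p ∈ S then 1 else if negPM p ∈ S then -1 else 0

/-- The coefficient of `τ_S` in the linear relation `x_p = x_q`. -/
def relCoeff {n : ℕ} (p q : PM n) (S : Finset (PM n)) : ℤ :=
  if S.card ≤ n - 2 then sgnPM p S - sgnPM q S
  else if S.card = n then (sgnPM p S - sgnPM q S) / 2 else 0

/-- The `D`-admissible subsets of `[±n]`. -/
def admSets (n : ℕ) : Finset (Finset (PM n)) := Finset.univ.filter (DAdm n)

/-- The admissible set representing a subset `A` of `U`: subsets with `n - 1` elements are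
replaced by the other full set that contains them. -/
def liftD {n : ℕ} (U A : Finset (PM n)) : Finset (PM n) :=
  if A.card = n - 1 then A ∪ (U \ A).image negPM else A

/-- The full set obtained from `F` by changing the sign of `r`. -/
def flipD {n : ℕ} (F : Finset (PM n)) (r : PM n) : Finset (PM n) := insert (negPM r) (F.erase r)

/-- The class attached to a subset `A` of `U`. -/
noncomputable def xD {n : ℕ} (U A : Finset (PM n)) : RD n := tauD n (liftD U A)

section Sets

variable {n : ℕ} {p q r : PM n} {A S T U F : Finset (PM n)}

@[simp] theorem negPM_negPM (p : PM n) : negPM (negPM p) = p := by simp [negPM]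

theorem negPM_ne (p : PM n) : negPM p ≠ p := by
  intro h
  have := congrArg Prod.snd h
  simp [negPM] at this

theorem negPM_injective : Function.Injective (negPM (n := n)) :=
  Function.LeftInverse.injective negPM_negPM

@[simp] theorem mem_admSets : S ∈ admSets n ↔ DAdm n S := by simp [admSets]

theorem injOn_fst_of_noAntipodes (h : ∀ p ∈ S, negPM p ∉ S) :
    Set.InjOn Prod.fst (S : Set (PM n)) := by
  rintro ⟨k, b⟩ hp ⟨l, c⟩ hq (rfl : k = l)
  have := h _ hp
  rcases eq_or_ne b c with rfl | hbc
  · rfl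
  · have hc : c = !b := by cases b <;> cases c <;> simp_all
    subst hc
    exact absurd hq this

theorem DAdm.card_le (h : DAdm n S) : S.card ≤ n := by
  have := Finset.card_image_of_injOn (injOn_fst_of_noAntipodes h.2.1)
  rw [← this]
  simpa using Finset.card_le_univ (S.image Prod.fst)

theorem DAdm.mem_or_neg_mem (h : DAdm n F) (hF : F.card = n) (p : PM n) :
    p ∈ F ∨ negPM p ∈ F := by
  have h1 := Finset.card_image_of_injOn (injOn_fst_of_noAntipodes h.2.1)
  have h2 : F.image Prod.fst = Finset.univ := by
    rw [← Finset.card_eq_iff_eq_univ]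
    simp [h1, hF]
  have h3 : p.1 ∈ F.image Prod.fst := h2 ▸ Finset.mem_univ _
  obtain ⟨q, hq, hqp⟩ := Finset.mem_image.1 h3
  rcases eq_or_ne q.2 p.2 with h4 | h4
  · left
    rwa [← Prod.ext hqp h4]
  · right
    have : negPM p = q := by
      refine Prod.ext hqp.symm ?_
      change (!p.2) = q.2
      cases hp : p.2 <;> cases hq : q.2 <;> simp_all
    rwa [this]

theorem DAdm.notMem_iff (h : DAdm n F) (hF : F.card = n) : p ∉ F ↔ negPM p ∈ F := by
  refine ⟨fun hp => (h.mem_or_neg_mem hF p).resolve_left hp, fun hp hp' => ?_⟩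
  exact h.2.1 p hp' hp

theorem DAdm.card_le_of_ne (h : DAdm n S) (hS : S.card ≠ n) : S.card ≤ n - 2 := by
  have := h.card_le
  have := h.2.2
  omega

theorem DAdm.card_of_ssubset (h : DAdm n S) (hT : DAdm n T) (hST : S ⊂ T) : S.card ≤ n - 2 := by
  have h1 := Finset.card_lt_card hST
  have := hT.card_le
  exact h.card_le_of_ne (by omega)

theorem DAdm.subset (h : DAdm n U) (hA : A.Nonempty) (hAU : A ⊆ U) (hc : A.card ≠ n - 1) :
    DAdm n A :=
  ⟨hA, fun p hp hp' => h.2.1 p (hAU hp) (hAU hp'), hc⟩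

theorem liftD_of_card (hA : A.card ≠ n - 1) : liftD U A = A := if_neg hA

theorem liftD_erase (hU : U.card = n) (hr : r ∈ U) :
    liftD U (U.erase r) = flipD U r := by
  have h1 : (U.erase r).card = n - 1 := by rw [Finset.card_erase_of_mem hr, hU]
  have h2 : U \ U.erase r = {r} := by
    rw [Finset.sdiff_erase hr]
    simp
  rw [liftD, if_pos h1, h2, Finset.image_singleton, Finset.union_comm, ← Finset.insert_eq, flipD]

theorem exists_eq_erase (hU : DAdm n U) (hA : A ⊂ U) (hc : A.card = n - 1) :
    U.card = n ∧ ∃ r ∈ U, A = U.erase r := by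
  have h1 := Finset.card_lt_card hA
  have h2 := hU.card_le
  have h3 : U.card = n := by omega
  obtain ⟨r, hr, hrA⟩ := Finset.exists_of_ssubset hA
  refine ⟨h3, r, hr, Finset.eq_of_subset_of_card_le ?_ ?_⟩
  · intro a ha
    rw [Finset.mem_erase]
    exact ⟨fun h => hrA (h ▸ ha), hA.1 ha⟩
  · rw [Finset.card_erase_of_mem hr]
    omega

theorem DAdm.card_flipD (hF : DAdm n F) (hc : F.card = n) (hr : r ∈ F) :
    (flipD F r).card = n := by
  rw [flipD, Finset.card_insert_of_notMem, Finset.card_erase_of_mem hr, hc]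
  · have : 0 < F.card := Finset.card_pos.2 ⟨r, hr⟩
    omega
  · exact fun h => hF.2.1 r hr (Finset.mem_of_mem_erase h)

theorem DAdm.flipD (hF : DAdm n F) (hc : F.card = n) (hr : r ∈ F) : DAdm n (flipD F r) := by
  have h1 := hF.card_flipD hc hr
  have h0 : 0 < F.card := Finset.card_pos.2 ⟨r, hr⟩
  refine ⟨⟨_, Finset.mem_insert_self _ _⟩, ?_, by omega⟩
  intro p hp hp'
  rw [_root_.flipD, Finset.mem_insert, Finset.mem_erase] at hp hp'
  rcases hp with rfl | hp
  · rcases hp' with hp' | hp'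
    · exact negPM_ne _ hp'
    · rw [negPM_negPM] at hp'
      exact hp'.1 rfl
  · rcases hp' with hp' | hp'
    · exact hp.1 (negPM_injective hp')
    · exact hF.2.1 p hp.2 hp'.2

theorem flipD_inter (hF : DAdm n F) (hr : r ∈ F) : flipD F r ∩ F = F.erase r := by
  ext a
  simp only [flipD, Finset.mem_inter, Finset.mem_insert, Finset.mem_erase]
  constructor
  · rintro ⟨rfl | h, h'⟩
    · exact absurd h' (hF.2.1 r hr)
    · exact h
  · exact fun h => ⟨Or.inr h, h.2⟩

theorem eq_flipD (hF : DAdm n F) (hc : F.card = n) (hS : DAdm n S) (hSc : S.card = n)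
    (hi : (S ∩ F).card = n - 1) : ∃ r ∈ F, S ∩ F = F.erase r ∧ S = flipD F r := by
  have h0 : 0 < F.card := Finset.card_pos.2 hF.1
  have hss : S ∩ F ⊂ F := by
    refine lt_of_le_of_ne Finset.inter_subset_right fun h => ?_
    rw [h] at hi
    omega
  obtain ⟨-, r, hr, hrF⟩ := exists_eq_erase hF hss hi
  refine ⟨r, hr, hrF, ?_⟩
  have hrS : r ∉ S := fun h => by
    have : r ∈ S ∩ F := Finset.mem_inter.2 ⟨h, hr⟩
    rw [hrF] at this
    exact (Finset.mem_erase.1 this).1 rfl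
  symm
  refine Finset.eq_of_subset_of_card_le (Finset.insert_subset ?_ ?_) ?_
  · exact (hS.notMem_iff hSc).1 hrS
  · rw [← hrF]
    exact Finset.inter_subset_left
  · rw [hSc, hF.card_flipD hc hr]

theorem liftD_cases (hU : DAdm n U) (hA : A ∈ Finset.Ioo ∅ U) :
    (U.card = n ∧ ∃ r ∈ U, A = U.erase r ∧ liftD U A = flipD U r) ∨
      (A.card ≠ n - 1 ∧ DAdm n A ∧ liftD U A = A) := by
  rw [Finset.mem_Ioo] at hA
  by_cases hc : A.card = n - 1
  · obtain ⟨hUn, r, hr, rfl⟩ := exists_eq_erase hU hA.2 hc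
    exact Or.inl ⟨hUn, r, hr, rfl, liftD_erase hUn hr⟩
  · exact Or.inr ⟨hc, hU.subset (Finset.nonempty_iff_ne_empty.2 hA.1.ne') hA.2.1 hc,
      liftD_of_card hc⟩

theorem DAdm.liftD (hU : DAdm n U) (hA : A ∈ Finset.Ioo ∅ U) : DAdm n (liftD U A) := by
  rcases liftD_cases hU hA with ⟨hUn, r, hr, -, h⟩ | ⟨-, hA', h⟩ <;> rw [h]
  · exact hU.flipD hUn hr
  · exact hA'

theorem liftD_inter (hU : DAdm n U) (hA : A ∈ Finset.Ioo ∅ U) : liftD U A ∩ U = A := by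
  rcases liftD_cases hU hA with ⟨hUn, r, hr, hr', h⟩ | ⟨-, -, h⟩ <;> rw [h]
  · rw [flipD_inter hU hr, hr']
  · exact Finset.inter_eq_left.2 (Finset.mem_Ioo.1 hA).2.1

theorem not_subset_liftD (hU : DAdm n U) (hA : A ∈ Finset.Ioo ∅ U) : ¬ U ⊆ liftD U A := by
  intro h
  have := liftD_inter hU hA
  rw [Finset.inter_eq_right.2 h] at this
  exact (Finset.mem_Ioo.1 hA).2.ne this.symm

theorem compat_liftD (hU : DAdm n U) (hA : A ∈ Finset.Ioo ∅ U) : Compat n (liftD U A) U := by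
  have hi := liftD_inter hU hA
  rcases liftD_cases hU hA with ⟨hUn, r, hr, hr', h⟩ | ⟨-, -, h⟩
  · refine Or.inr (Or.inr ⟨?_, hUn, ?_⟩)
    · rw [h, hU.card_flipD hUn hr]
    · rw [hi, hr', Finset.card_erase_of_mem hr, hUn]
  · rw [h]
    exact Or.inl (Finset.mem_Ioo.1 hA).2.1

theorem not_compat_liftD {B : Finset (PM n)} (hU : DAdm n U) (hA : A ∈ Finset.Ioo ∅ U)
    (hB : B ∈ Finset.Ioo ∅ U) (hAB : ¬ A ⊆ B) (hBA : ¬ B ⊆ A) :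
    ¬ Compat n (liftD U A) (liftD U B) := by
  have hcard : ∀ {A : Finset (PM n)}, A ∈ Finset.Ioo ∅ U → (liftD U A).card = n →
      ∃ r ∈ U, A = U.erase r ∧ liftD U A = flipD U r := by
    intro A hA hc
    rcases liftD_cases hU hA with h | ⟨h1, h2, h3⟩
    · exact h.2
    · have := Finset.card_lt_card (Finset.mem_Ioo.1 hA).2
      have := hU.card_le
      rw [h3] at hc
      omega
  rintro (h | h | h)
  · apply hAB
    rw [← liftD_inter hU hA, ← liftD_inter hU hB]
    exact Finset.inter_subset_inter_right h
  · apply hBA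
    rw [← liftD_inter hU hA, ← liftD_inter hU hB]
    exact Finset.inter_subset_inter_right h
  · obtain ⟨r, hr, rfl, hr'⟩ := hcard hA h.1
    obtain ⟨s, hs, rfl, hs'⟩ := hcard hB h.2.1
    have hrs : r ≠ s := by
      rintro rfl
      exact hAB subset_rfl
    obtain ⟨t, -, hi, -⟩ := eq_flipD (hU.liftD hB) h.2.1 (hU.liftD hA) h.1 h.2.2
    rw [hr', hs'] at hi
    have h1 : negPM s = t := by
      by_contra hne
      have : negPM s ∈ (flipD U s).erase t := by simp [flipD, hne]
      rw [← hi] at this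
      simp only [flipD, Finset.mem_inter, Finset.mem_insert, Finset.mem_erase] at this
      rcases this.1 with h | h
      · exact hrs (negPM_injective h).symm
      · exact hU.2.1 s hs h.2
    have h2 : r = t := by
      by_contra hne
      have : r ∈ (flipD U s).erase t := by simp [flipD, hne, hr, hrs]
      rw [← hi] at this
      simp only [flipD, Finset.mem_inter, Finset.mem_insert, Finset.mem_erase] at this
      rcases this.1 with h | h
      · exact negPM_ne r h.symm
      · exact h.1 rfl
    exact hU.2.1 s hs (by rwa [h1, ← h2])

end Sets

section Ring

variable {n : ℕ} {p q r : PM n} {A S T U F : Finset (PM n)}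

theorem tauD_mul_eq_zero (hS : DAdm n S) (hT : DAdm n T) (h : ¬ Compat n S T) :
    tauD n S * tauD n T = 0 := by
  rw [tauD, tauD, dif_pos hS, dif_pos hT, ← map_mul, Ideal.Quotient.eq_zero_iff_mem]
  exact Ideal.subset_span (Or.inl ⟨⟨S, hS⟩, ⟨T, hT⟩, h, rfl⟩)

theorem sum_relCoeff (hn : 2 ≤ n) (hpq : p.1 ≠ q.1) :
    ∑ S ∈ admSets n, (relCoeff p q S : RD n) * tauD n S = 0 := by
  obtain ⟨k, b⟩ := p
  obtain ⟨l, c⟩ := q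
  have hs : ∀ (k : Fin n) (b : Bool) (S : Finset (PM n)), DAdm n S →
      sgnPM (k, b) S = (if b then 1 else -1) * eps n k S := by
    intro k b S hS
    have := hS.2.1 (k, b)
    simp only [sgnPM, eps, negPM] at this ⊢
    cases b <;> simp_all
    split_ifs <;> simp_all
  have hodd : ∀ (k : Fin n) (S : Finset (PM n)), DAdm n S → S.card = n →
      eps n k S = 1 ∨ eps n k S = -1 := by
    intro k S hS hc
    have := hS.mem_or_neg_mem hc (k, true)
    simp only [eps, negPM] at this ⊢
    rcases this with h | h
    · simp [h]
    · simp only [Bool.not_true] at h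
      simp only [h, if_true]
      split_ifs <;> simp
  set e : ℤ := (if b then 1 else -1) * (if c then 1 else -1) with he
  have hmem : (∑ S : IdxD n, if S.1.card ≤ n - 2 then
        C (eps n k S.1 - e * eps n l S.1) * X S else 0) +
      (∑ S : IdxD n, if S.1.card = n then C ((eps n k S.1 - e * eps n l S.1) / 2) * X S else 0)
        ∈ Ideal.span (relD n) := by
    refine Ideal.subset_span (Or.inr ⟨k, l, e, ?_, hpq, rfl⟩)
    cases b <;> cases c <;> simp [he]
  rw [← Ideal.Quotient.eq_zero_iff_mem] at hmem
  have key : ∑ S ∈ admSets n, (relCoeff (k, b) (l, c) S : RD n) * tauD n S =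
      ((if b then 1 else -1 : ℤ) : RD n) * Ideal.Quotient.mk (Ideal.span (relD n))
        ((∑ S : IdxD n, if S.1.card ≤ n - 2 then
          C (eps n k S.1 - e * eps n l S.1) * X S else 0) +
        (∑ S : IdxD n, if S.1.card = n then
          C ((eps n k S.1 - e * eps n l S.1) / 2) * X S else 0)) := by
    rw [Finset.sum_subtype (admSets n) (p := DAdm n) (fun S => mem_admSets), ← Finset.sum_add_distrib,
      map_sum, Finset.mul_sum]
    refine Finset.sum_congr rfl fun S _ => ?_
    have hC : ∀ z : ℤ, Ideal.Quotient.mk (Ideal.span (relD n)) (C z) = (z : RD n) := fun z => by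
      simp
    rw [tauD, dif_pos S.2]
    have h1 := hs k b S.1 S.2
    have h2 := hs l c S.1 S.2
    by_cases hc1 : S.1.card ≤ n - 2
    · have hc2 : S.1.card ≠ n := by omega
      rw [relCoeff, if_pos hc1, if_pos hc1, if_neg hc2, add_zero, map_mul, hC, ← mul_assoc,
        ← Int.cast_mul, h1, h2]
      congr 2
      rw [he]
      cases b <;> cases c <;> simp <;> ring
    · have hc2 : S.1.card = n := by
        by_contra hne
        exact hc1 (S.2.card_le_of_ne hne)
      rw [relCoeff, if_neg hc1, if_neg hc1, if_pos hc2, if_pos hc2, zero_add, map_mul, hC,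
        ← mul_assoc, ← Int.cast_mul, h1, h2]
      congr 2
      rw [he]
      rcases hodd k S.1 S.2 hc2 with h3 | h3 <;> rcases hodd l S.1 S.2 hc2 with h4 | h4 <;>
        rw [h3, h4] <;> cases b <;> cases c <;> norm_num
  rw [key, hmem, mul_zero]

theorem tauD_mul_sum (hn : 2 ≤ n) (hU : DAdm n U) (f : Finset (PM n) → ℤ) :
    tauD n U * ∑ S ∈ admSets n, (f S : RD n) * tauD n S =
      tauD n U * (∑ A ∈ Finset.Ioo ∅ U, (f (liftD U A) : RD n) * xD U A + f U * tauD n U +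
        ∑ S ∈ (admSets n).filter (fun S => U ⊂ S), (f S : RD n) * tauD n S) := by
  have e1 : ∑ A ∈ Finset.Ioo ∅ U, (f (liftD U A) : RD n) * xD U A =
      ∑ S ∈ (admSets n).filter (fun S => Compat n S U ∧ ¬ U ⊆ S), (f S : RD n) * tauD n S := by
    refine Finset.sum_nbij' (fun A => liftD U A) (fun S => S ∩ U) ?_ ?_ ?_ ?_ (fun _ _ => rfl)
    · intro A hA
      rw [Finset.mem_filter, mem_admSets]
      exact ⟨hU.liftD hA, compat_liftD hU hA, not_subset_liftD hU hA⟩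
    · intro S hS
      rw [Finset.mem_filter, mem_admSets] at hS
      rw [Finset.mem_Ioo]
      refine ⟨?_, lt_of_le_of_ne Finset.inter_subset_right fun h => hS.2.2 ?_⟩
      · rw [Finset.empty_ssubset, ← Finset.card_pos]
        rcases hS.2.1 with h | h | h
        · rw [Finset.inter_eq_left.2 h]
          exact Finset.card_pos.2 hS.1.1
        · exact absurd h hS.2.2
        · omega
      · exact Finset.inter_eq_right.1 h
    · exact fun A hA => liftD_inter hU hA
    · intro S hS
      rw [Finset.mem_filter, mem_admSets] at hS
      rcases hS.2.1 with h | h | h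
      · rw [Finset.inter_eq_left.2 h, liftD_of_card hS.1.2.2]
      · exact absurd h hS.2.2
      · obtain ⟨r, hr, hr1, hr2⟩ := eq_flipD hU h.2.1 hS.1 h.1 h.2.2
        rw [hr1, liftD_erase h.2.1 hr, hr2]
  have e2 : tauD n U * ∑ S ∈ admSets n, (f S : RD n) * tauD n S =
      tauD n U * ∑ S ∈ (admSets n).filter (fun S => Compat n S U), (f S : RD n) * tauD n S := by
    rw [← Finset.sum_filter_add_sum_filter_not _ (fun S => Compat n S U), mul_add,
      add_eq_left, Finset.mul_sum]
    refine Finset.sum_eq_zero fun S hS => ?_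
    rw [Finset.mem_filter, mem_admSets] at hS
    linear_combination (f S : RD n) * tauD_mul_eq_zero hS.1 hU hS.2
  rw [e2, e1, ← Finset.sum_filter_add_sum_filter_not
    ((admSets n).filter (fun S => Compat n S U)) (fun S => U ⊆ S), Finset.filter_filter,
    Finset.filter_filter, add_comm (∑ S ∈ _, _), add_assoc]
  congr 2
  have e3 : (admSets n).filter (fun S => Compat n S U ∧ U ⊆ S) =
      insert U ((admSets n).filter (fun S => U ⊂ S)) := by
    ext S
    simp only [Finset.mem_filter, Finset.mem_insert, mem_admSets]
    constructor
    · rintro ⟨h1, h2, h3⟩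
      rcases eq_or_ne S U with h | h
      · exact Or.inl h
      · exact Or.inr ⟨h1, lt_of_le_of_ne h3 h.symm⟩
    · rintro (rfl | h)
      · exact ⟨hU, Or.inl subset_rfl, subset_rfl⟩
      · exact ⟨h.1, Or.inr (Or.inl h.2.1), h.2.1⟩
  rw [e3, Finset.sum_insert]
  simp
end Ring

theorem PermRel.mul_sq_coatom {α R : Type*} [DecidableEq α] [CommRing R] {x : Finset α → R} {w : R}
    {T U : Finset α} {p r : α} (h : PermRel x w T U) (hr : r ∈ U) (hrT : U.erase r ∈ Finset.Ioo T U)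
    (hp : p ∈ U.erase r \ T) :
    w * x (U.erase r) * x (U.erase r) = - (w * x (U.erase r) * psiLow x T (U.erase r) p) := by
  have hr' : r ∈ U \ U.erase r := by simp [hr]
  have h1 : U \ U.erase r = {r} := by
    rw [Finset.sdiff_erase hr]
    simp
  have hG := Finset.mem_Ioo.1 hrT
  have hrU : r ∈ U \ T := Finset.mem_sdiff.2 ⟨hr, fun h => (Finset.mem_erase.1 (hG.1.1 h)).1 rfl⟩
  have hpU := Finset.sdiff_subset_sdiff hG.2.1 (Finset.Subset.refl T) hp
  have h2 := (h.upper hrT).low_pow_mul_up_pow_eq_zero hr' hr' (i := 1) (j := 0) (by simp [h1])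
  rw [pow_one, pow_zero, mul_one, ← h.low_restrict hrT hr'] at h2
  have h3 : w * x (U.erase r) * psiLow x T U p =
      w * x (U.erase r) * (x (U.erase r) + psiLow x T (U.erase r) p) := by
    have h4 : x (U.erase r) + psiLow x T (U.erase r) p =
        ∑ A ∈ insert (U.erase r) ((Finset.Ioo T (U.erase r)).filter (fun A => p ∈ A)), x A := by
      rw [Finset.sum_insert (by simp), psiLow]
    rw [h4, psiLow, Finset.mul_sum, Finset.mul_sum]
    symm
    apply Finset.sum_subset
    · intro A hA
      simp only [Finset.mem_insert, Finset.mem_filter, Finset.mem_Ioo] at hA ⊢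
      rcases hA with rfl | hA
      · exact ⟨hG, (Finset.mem_sdiff.1 hp).1⟩
      · exact ⟨⟨hA.1.1, hA.1.2.trans hG.2⟩, hA.2⟩
    · intro A hA hA'
      simp only [Finset.mem_insert, Finset.mem_filter, Finset.mem_Ioo, not_or, not_and] at hA hA'
      refine h.mul_eq_zero _ hrT A (Finset.mem_Ioo.2 hA.1) (fun hGA => ?_) (fun hAG => ?_)
      · have hlt : U.erase r ⊂ A := lt_of_le_of_ne hGA (Ne.symm hA'.1)
        have e1 := Finset.card_lt_card hlt
        have e2 := Finset.card_lt_card hA.1.2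
        rw [Finset.card_erase_of_mem hr] at e1
        omega
      · exact hA'.2 ⟨hA.1.1, lt_of_le_of_ne hAG hA'.1⟩ hA.2
  linear_combination -h3 + x (U.erase r) * h.low_congr p hpU r hrU + h2

theorem PermRel.upper_of_ssubset {α R : Type*} [DecidableEq α] [CommRing R] {x : Finset α → R}
    {w : R} {T U : Finset α} (h : PermRel x w ∅ U) (h1 : x ∅ = 1) (hT : T ⊂ U) :
    PermRel x (w * x T) T U := by
  rcases T.eq_empty_or_nonempty with rfl | hne
  · rwa [h1, mul_one]
  · exact h.upper (Finset.mem_Ioo.2 ⟨Finset.empty_ssubset.2 hne, hT⟩)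

theorem PermRel.gap_eq_zero {α R : Type*} [DecidableEq α] [CommRing R] {x : Finset α → R} {w : R}
    {T U : Finset α} {p q : α} (h : PermRel x w ∅ U) (h1 : x ∅ = 1) (hT : T ⊂ U) (hp : p ∈ U)
    (hq : q ∈ U \ T) {i j : ℕ} (hij : (U \ T).card ≤ i + j) :
    w * x T * psiLow x ∅ U p ^ i * psiUp x T U q ^ j = 0 := by
  have hp' : p ∈ U \ ∅ := by simpa using hp
  rw [← (h.upper_of_ssubset h1 hT).low_pow_mul_up_pow_eq_zero hq hq hij]
  congr 1
  rcases T.eq_empty_or_nonempty with rfl | hne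
  · rw [h1, mul_one]
    exact mul_pow_congr (h.low_congr p hp' q hq) i
  · exact h.low_pow_restrict (Finset.mem_Ioo.2 ⟨Finset.empty_ssubset.2 hne, hT⟩) hp' hq i

theorem PermRel.gap_eq {α R : Type*} [DecidableEq α] [CommRing R] {x : Finset α → R} {w : R}
    {T U : Finset α} {p q r : α} (h : PermRel x w ∅ U) (h1 : x ∅ = 1) (hT : T ⊂ U) (hp : p ∈ U)
    (hq : q ∈ U \ T) (hr : T.Nonempty → r ∈ T) {i j : ℕ} (hij : i + j + 1 = (U \ T).card) :
    w * x T * psiLow x ∅ T r ^ (T.card - 1) * psiLow x ∅ U p ^ i * psiUp x T U q ^ j =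
      ((U \ T).card - 1).choose i * (w * psiLow x ∅ U p ^ (U.card - 1)) := by
  have hp' : p ∈ U \ ∅ := by simpa using hp
  have key := (h.upper_of_ssubset h1 hT).low_pow_mul_up_pow hT hq hq hij
  rcases T.eq_empty_or_nonempty with rfl | hne
  · rw [h1, mul_one] at key ⊢
    rw [mul_pow_congr (h.low_congr q hq p hp'), mul_pow_congr (h.low_congr q hq p hp')] at key
    rw [Finset.card_empty, Nat.zero_sub, pow_zero, mul_one, key, Finset.sdiff_empty]
  · have hTm := Finset.mem_Ioo.2 ⟨Finset.empty_ssubset.2 hne, hT⟩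
    have hr' : r ∈ T \ ∅ := by simpa using hr hne
    have h2 := h.low_pow_trans hTm hr' hq hp'
    have h3 := h.low_pow_restrict hTm hp' hq i
    simp only [Finset.sdiff_empty] at h2
    linear_combination psiLow x ∅ T r ^ (T.card - 1) * key +
      ((U \ T).card - 1).choose i * h2 +
      psiLow x ∅ T r ^ (T.card - 1) * psiUp x T U q ^ j * h3

/-- The coefficient of `τ_S` in `ψ⁺`. -/
def upCoeff {n : ℕ} (q : PM n) (S : Finset (PM n)) : ℤ :=
  if S.card ≤ n - 2 then 1 - sgnPM q S
  else if S.card = n then (if negPM q ∈ S then 1 else 0) else 0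

/-- The class `ψ⁺` of an admissible set `T`, computed with the signed index `q`. -/
noncomputable def psiP {n : ℕ} (T : Finset (PM n)) (q : PM n) : RD n :=
  ∑ S ∈ (admSets n).filter (fun S => T ⊂ S), (upCoeff q S : RD n) * tauD n S

section DRing

variable {n : ℕ} {p q r : PM n} {A S T U F : Finset (PM n)}

theorem fst_ne_of_mem (hU : DAdm n U) (hp : p ∈ U) (hq : q ∈ U) (h : p ≠ q) : p.1 ≠ q.1 :=
  fun he => h (injOn_fst_of_noAntipodes hU.2.1 hp hq he)

theorem sgnPM_of_mem (hp : p ∈ S) : sgnPM p S = 1 := if_pos hp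

theorem sgnPM_of_neg_mem (hU : DAdm n S) (hp : negPM p ∈ S) : sgnPM p S = -1 := by
  have : p ∉ S := fun h => hU.2.1 p h hp
  rw [sgnPM, if_neg this, if_pos hp]

theorem sgnPM_of_subset (hU : DAdm n U) (hA : A ⊆ U) (hp : p ∈ U) :
    sgnPM p A = if p ∈ A then 1 else 0 := by
  have : negPM p ∉ A := fun h => hU.2.1 p hp (hA h)
  simp [sgnPM, this]

theorem sgnPM_neg (hS : DAdm n S) : sgnPM (negPM p) S = - sgnPM p S := by
  have := hS.2.1 p
  simp only [sgnPM, negPM_negPM]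
  split_ifs <;> simp_all

theorem sgnPM_flipD (hp : p ∈ F) (hF : DAdm n F) :
    sgnPM p (flipD F r) = if p = r then -1 else 1 := by
  have h1 := hF.2.1 p hp
  split_ifs with h
  · subst h
    simp [sgnPM, flipD, (negPM_ne p).symm]
  · simp [sgnPM, flipD, h, hp]

theorem relCoeff_liftD (hn : 2 ≤ n) (hU : DAdm n U) (hA : A ∈ Finset.Ioo ∅ U) (hp : p ∈ U)
    (hq : q ∈ U) :
    relCoeff p q (liftD U A) = (if p ∈ A then 1 else 0) - (if q ∈ A then 1 else 0) := by
  rcases liftD_cases hU hA with ⟨hUn, r, hr, rfl, h⟩ | ⟨hc, hA', h⟩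
  · rw [h, relCoeff, hU.card_flipD hUn hr, if_neg (by omega), if_pos rfl, sgnPM_flipD hp hU,
      sgnPM_flipD hq hU]
    simp only [Finset.mem_erase, hp, hq, and_true, ne_eq]
    split_ifs <;> simp_all
  · have hAU := Finset.mem_Ioo.1 hA
    rw [h, relCoeff, if_pos (hA'.card_of_ssubset hU hAU.2), sgnPM_of_subset hU hAU.2.1 hp,
      sgnPM_of_subset hU hAU.2.1 hq]

theorem permRel_xD (hn : 2 ≤ n) (hU : DAdm n U) : PermRel (xD U) (tauD n U) ∅ U where
  mul_eq_zero A hA B hB hAB hBA := by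
    have := tauD_mul_eq_zero (hU.liftD hA) (hU.liftD hB) (not_compat_liftD hU hA hB hAB hBA)
    rw [mul_assoc, xD, xD, this, mul_zero]
  low_congr p hp q hq := by
    rw [Finset.sdiff_empty] at hp hq
    rcases eq_or_ne p q with rfl | hpq
    · rfl
    have h := tauD_mul_sum hn hU (relCoeff p q)
    rw [sum_relCoeff hn (fst_ne_of_mem hU hp hq hpq), mul_zero] at h
    have hz : ∀ S, U ⊆ S → relCoeff p q S = 0 := by
      intro S hS
      simp [relCoeff, sgnPM_of_mem (hS hp), sgnPM_of_mem (hS hq)]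
    have h2 : ∑ A ∈ Finset.Ioo ∅ U, (relCoeff p q (liftD U A) : RD n) * xD U A =
        psiLow (xD U) ∅ U p - psiLow (xD U) ∅ U q := by
      rw [psiLow, psiLow, Finset.sum_filter, Finset.sum_filter, ← Finset.sum_sub_distrib]
      refine Finset.sum_congr rfl fun A hA => ?_
      rw [relCoeff_liftD hn hU hA hp hq]
      split_ifs <;> push_cast <;> ring
    have h3 : ∑ S ∈ (admSets n).filter (fun S => U ⊂ S), (relCoeff p q S : RD n) * tauD n S = 0 :=
      Finset.sum_eq_zero fun S hS => by
        rw [hz S (Finset.mem_filter.1 hS).2.1, Int.cast_zero, zero_mul]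
    rw [h2, h3, hz U subset_rfl] at h
    push_cast at h
    linear_combination -h

theorem tauD_sq (hn : 2 ≤ n) (hT : DAdm n T) (hc : T.card ≤ n - 2) (hp : p ∈ T) (hq : q ∉ T)
    (hq' : negPM q ∉ T) :
    tauD n T * tauD n T = - (tauD n T * (psiLow (xD T) ∅ T p + psiP T q)) := by
  have hpq : p.1 ≠ q.1 := by
    intro h
    rcases eq_or_ne p.2 q.2 with h2 | h2
    · exact hq (Prod.ext h h2 ▸ hp)
    · apply hq'
      have : negPM q = p := by
        refine Prod.ext h.symm ?_
        change (!q.2) = p.2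
        cases hp : p.2 <;> cases hq : q.2 <;> simp_all
      rwa [this]
  have h := tauD_mul_sum hn hT (relCoeff p q)
  rw [sum_relCoeff hn hpq, mul_zero] at h
  have h1 : relCoeff p q T = 1 := by
    rw [relCoeff, if_pos hc, sgnPM_of_mem hp]
    simp [sgnPM, hq, hq']
  have h2 : ∑ A ∈ Finset.Ioo ∅ T, (relCoeff p q (liftD T A) : RD n) * xD T A =
      psiLow (xD T) ∅ T p := by
    rw [psiLow, Finset.sum_filter]
    refine Finset.sum_congr rfl fun A hA => ?_
    have hAT := Finset.mem_Ioo.1 hA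
    have hcA := Finset.card_lt_card hAT.2
    rw [liftD_of_card (by omega), relCoeff, if_pos (by omega), sgnPM_of_subset hT hAT.2.1 hp]
    have e1 : q ∉ A := fun h => hq (hAT.2.1 h)
    have e2 : negPM q ∉ A := fun h => hq' (hAT.2.1 h)
    have e3 : sgnPM q A = 0 := by simp [sgnPM, e1, e2]
    rw [e3]
    split_ifs <;> simp
  have h3 : ∑ S ∈ (admSets n).filter (fun S => T ⊂ S), (relCoeff p q S : RD n) * tauD n S =
      psiP T q := by
    refine Finset.sum_congr rfl fun S hS => ?_
    rw [Finset.mem_filter, mem_admSets] at hS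
    congr 2
    rw [relCoeff, upCoeff, sgnPM_of_mem (hS.2.1 hp)]
    split_ifs with c1 c2 c3
    · rfl
    · rw [sgnPM_of_neg_mem hS.1 c3]
      rfl
    · have := (hS.1.mem_or_neg_mem c2 q).resolve_right c3
      rw [sgnPM_of_mem this]
      rfl
    · rfl
  rw [h1, h2, h3] at h
  push_cast at h
  linear_combination -h

theorem tauD_mul_psiP (hn : 2 ≤ n) (hU : DAdm n U) (hT : T ⊂ U) (hc : T.card ≤ n - 2)
    (hq : q ∈ U \ T) :
    tauD n U * psiP T q = tauD n U * psiUp (xD U) T U q := by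
  obtain ⟨hqU, hqT⟩ := Finset.mem_sdiff.1 hq
  have h := tauD_mul_sum hn hU (fun S => if T ⊂ S then upCoeff q S else 0)
  have hz : ∀ S, DAdm n S → U ⊆ S → upCoeff q S = 0 := by
    intro S hS hUS
    simp [upCoeff, sgnPM_of_mem (hUS hqU), hS.2.1 q (hUS hqU)]
  have h0 : ∑ S ∈ admSets n, ((if T ⊂ S then upCoeff q S else 0 : ℤ) : RD n) * tauD n S =
      psiP T q := by
    rw [psiP, Finset.sum_filter]
    refine Finset.sum_congr rfl fun S _ => ?_
    split_ifs <;> simp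
  have h2 : ∑ A ∈ Finset.Ioo ∅ U,
      ((if T ⊂ liftD U A then upCoeff q (liftD U A) else 0 : ℤ) : RD n) * xD U A =
      psiUp (xD U) T U q := by
    rw [psiUp]
    symm
    have hsub : (Finset.Ioo T U).filter (fun A => q ∉ A) ⊆ Finset.Ioo ∅ U := by
      intro A hA
      simp only [Finset.mem_filter, Finset.mem_Ioo] at hA ⊢
      exact ⟨lt_of_le_of_lt (Finset.empty_subset T) hA.1.1, hA.1.2⟩
    have hcoef : ∀ A ∈ Finset.Ioo ∅ U,
        (if T ⊂ liftD U A then upCoeff q (liftD U A) else 0) =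
          if A ∈ (Finset.Ioo T U).filter (fun A => q ∉ A) then 1 else 0 := by
      intro A hA
      have hAU := Finset.mem_Ioo.1 hA
      have hiff : T ⊂ liftD U A ↔ T ⊂ A := by
        rcases liftD_cases hU hA with ⟨hUn, r, hr, rfl, h⟩ | ⟨hc, hA', h⟩
        · have e1 : (U.erase r).card = n - 1 := by rw [Finset.card_erase_of_mem hr, hUn]
          constructor
          · intro hTl
            refine lt_of_le_of_ne ?_ ?_
            · rw [← liftD_inter hU hA]
              exact Finset.subset_inter hTl.1 hT.1
            · rintro rfl
              omega
          · intro hTl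
            rw [h]
            refine lt_of_lt_of_le hTl ?_
            exact Finset.subset_insert _ _
        · rw [h]
      simp only [hiff, Finset.mem_filter, Finset.mem_Ioo]
      by_cases hTA : T ⊂ A
      · rw [if_pos hTA]
        simp only [hTA, hAU.2, true_and]
        rcases liftD_cases hU hA with ⟨hUn, r, hr, rfl, h⟩ | ⟨hc, hA', h⟩
        · rw [h, upCoeff, hU.card_flipD hUn hr, if_neg (by omega), if_pos rfl]
          have : negPM q ∈ flipD U r ↔ q ∉ U.erase r := by
            have := hU.2.1 q hqU
            simp only [flipD, Finset.mem_insert, Finset.mem_erase, hqU, this, and_false, or_false,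
              and_true, not_not, negPM_injective.eq_iff, ne_eq]
          simp only [this]
        · rw [h, upCoeff, if_pos (hA'.card_of_ssubset hU hAU.2), sgnPM_of_subset hU hAU.2.1 hqU]
          split_ifs <;> simp_all
      · rw [if_neg hTA, if_neg]
        exact fun h => hTA h.1.1
    have hcoef' : ∀ A ∈ Finset.Ioo ∅ U,
        ((if T ⊂ liftD U A then upCoeff q (liftD U A) else 0 : ℤ) : RD n) * xD U A =
          if A ∈ (Finset.Ioo T U).filter (fun A => q ∉ A) then xD U A else 0 := by
      intro A hA
      rw [hcoef A hA]
      split_ifs <;> simp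
    rw [Finset.sum_congr rfl hcoef', ← Finset.sum_subset hsub]
    · exact Finset.sum_congr rfl fun A hA => (if_pos hA).symm
    · exact fun A _ hA => if_neg hA
  have h3 : ∑ S ∈ (admSets n).filter (fun S => U ⊂ S),
      ((if T ⊂ S then upCoeff q S else 0 : ℤ) : RD n) * tauD n S = 0 :=
    Finset.sum_eq_zero fun S hS => by
      rw [Finset.mem_filter, mem_admSets] at hS
      simp [hz S hS.1 hS.2.1]
  rw [h0, h2, h3, hz U hU subset_rfl] at h
  rw [h]
  simp

theorem tauD_sq_of_full (hn : 2 ≤ n) (hF : DAdm n F) (hc : F.card = n) (hp : p ∈ F) :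
    tauD n F * tauD n F =
      tauD n F * (∑ r ∈ F, tauD n (flipD F r) - 2 * psiLow (xD F) ∅ F p) := by
  obtain ⟨q, hq, hqp⟩ : ∃ q ∈ F, q ≠ p := by
    by_contra! hne
    have : F ⊆ {p} := fun q hq => Finset.mem_singleton.2 (hne q hq)
    have := Finset.card_le_card this
    simp at this
    omega
  have hpq : p.1 ≠ (negPM q).1 := fst_ne_of_mem (q := q) hF hp hq hqp.symm
  have h := tauD_mul_sum hn hF (relCoeff p (negPM q))
  rw [sum_relCoeff hn hpq, mul_zero] at h
  have h1 : relCoeff p (negPM q) F = 1 := by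
    rw [relCoeff, if_neg (by omega), if_pos hc, sgnPM_of_mem hp, sgnPM_neg hF, sgnPM_of_mem hq]
    rfl
  have hsum : ∑ r ∈ F, tauD n (flipD F r) =
      ∑ A ∈ (Finset.Ioo ∅ F).filter (fun A => A.card = n - 1), xD F A := by
    refine Finset.sum_bij (fun r _ => F.erase r) ?_ ?_ ?_ ?_
    · intro r hr
      have e1 : (F.erase r).card = n - 1 := by rw [Finset.card_erase_of_mem hr, hc]
      refine Finset.mem_filter.2 ⟨Finset.mem_Ioo.2 ⟨?_, Finset.erase_ssubset hr⟩, e1⟩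
      exact Finset.empty_ssubset.2 (Finset.card_pos.1 (by omega))
    · intro r hr s hs hrs
      by_contra hne
      have : r ∈ F.erase s := Finset.mem_erase.2 ⟨hne, hr⟩
      rw [← hrs] at this
      exact (Finset.mem_erase.1 this).1 rfl
    · intro A hA
      rw [Finset.mem_filter, Finset.mem_Ioo] at hA
      obtain ⟨-, r, hr, rfl⟩ := exists_eq_erase hF hA.1.2 hA.2
      exact ⟨r, hr, rfl⟩
    · intro r hr
      rw [xD, liftD_erase hc hr]
  have h2 : ∑ A ∈ Finset.Ioo ∅ F, (relCoeff p (negPM q) (liftD F A) : RD n) * xD F A =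
      psiLow (xD F) ∅ F p + psiLow (xD F) ∅ F q - ∑ r ∈ F, tauD n (flipD F r) := by
    rw [psiLow, psiLow, hsum, Finset.sum_filter, Finset.sum_filter, Finset.sum_filter,
      ← Finset.sum_add_distrib, ← Finset.sum_sub_distrib]
    refine Finset.sum_congr rfl fun A hA => ?_
    rcases liftD_cases hF hA with ⟨hUn, r, hr, rfl, h⟩ | ⟨hcA, hA', h⟩
    · have e1 : (F.erase r).card = n - 1 := by rw [Finset.card_erase_of_mem hr, hc]
      rw [h, relCoeff, hF.card_flipD hUn hr, if_neg (by omega), if_pos rfl,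
        sgnPM_neg (hF.flipD hc hr), sgnPM_flipD hp hF, sgnPM_flipD hq hF, if_pos e1]
      simp only [Finset.mem_erase, hp, hq, and_true, ne_eq]
      clear * - hqp
      split_ifs <;> simp_all
    · have hAU := Finset.mem_Ioo.1 hA
      rw [h, relCoeff, if_pos (hA'.card_of_ssubset hF hAU.2), sgnPM_neg hA',
        sgnPM_of_subset hF hAU.2.1 hp, sgnPM_of_subset hF hAU.2.1 hq, if_neg hcA]
      split_ifs <;> simp
      ring
  have h3 : ∑ S ∈ (admSets n).filter (fun S => F ⊂ S),
      (relCoeff p (negPM q) S : RD n) * tauD n S = 0 :=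
    Finset.sum_eq_zero fun S hS => by
      rw [Finset.mem_filter, mem_admSets] at hS
      have := Finset.card_lt_card hS.2
      have := hS.1.card_le
      omega
  rw [h1, h2, h3] at h
  push_cast at h
  linear_combination -h + (permRel_xD hn hF).low_congr p (by simpa using hp) q (by simpa using hq)
end DRing

section Gap

variable {n : ℕ} {p q r : PM n} {A S T U F : Finset (PM n)}

/-- The class `ψ⁻` of an admissible set `U`. -/
noncomputable def psiM {n : ℕ} (U : Finset (PM n)) : RD n :=
  if h : U.Nonempty then psiLow (xD U) ∅ U h.choose else 0

/-- The product of `τ_U` and the class of a point below `U`. -/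
noncomputable def pD {n : ℕ} (U : Finset (PM n)) : RD n := tauD n U * psiM U ^ (U.card - 1)

theorem tauD_empty : tauD n ∅ = 1 := dif_neg fun h => Finset.not_nonempty_empty h.1

theorem xD_of_card (h : A.card ≠ n - 1) : xD U A = tauD n A := by
  rw [xD, liftD_of_card h]

theorem xD_empty (hn : 2 ≤ n) : xD U ∅ = 1 := by
  rw [xD_of_card (by rw [Finset.card_empty]; omega), tauD_empty]

theorem pD_empty : pD (∅ : Finset (PM n)) = 1 := by
  rw [pD, tauD_empty, Finset.card_empty, pow_zero, one_mul]

theorem tauD_mul_psiM (hn : 2 ≤ n) (hU : DAdm n U) (hp : p ∈ U) :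
    tauD n U * psiM U = tauD n U * psiLow (xD U) ∅ U p := by
  rw [psiM, dif_pos hU.1]
  exact (permRel_xD hn hU).low_congr _ (by simpa using hU.1.choose_spec) _ (by simpa using hp)

theorem pD_eq (hn : 2 ≤ n) (hU : DAdm n U) (hp : p ∈ U) :
    pD U = tauD n U * psiLow (xD U) ∅ U p ^ (U.card - 1) :=
  mul_pow_congr (tauD_mul_psiM hn hU hp) _

theorem psiLow_xD_congr (V : Finset (PM n)) (hT : T.card ≤ n - 1) :
    psiLow (xD U) ∅ T p = psiLow (xD V) ∅ T p := by
  refine Finset.sum_congr rfl fun A hA => ?_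
  have := Finset.card_lt_card (Finset.mem_Ioo.1 (Finset.mem_filter.1 hA).1).2
  rw [xD_of_card (by omega), xD_of_card (by omega)]

theorem dAdm_of_ssubset (hU : DAdm n U) (hT : T ⊂ U) (hc : T.card ≤ n - 2) (h : T.Nonempty) :
    DAdm n T := by
  have := Finset.card_pos.2 h
  exact hU.subset h hT.1 (by omega)

theorem tauD_mul_psiP_pow (hn : 2 ≤ n) (hU : DAdm n U) (hT : T ⊂ U) (hc : T.card ≤ n - 2)
    (hq : q ∈ U \ T) (k : ℕ) :
    tauD n U * psiP T q ^ k = tauD n U * psiUp (xD U) T U q ^ k :=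
  mul_pow_congr (tauD_mul_psiP hn hU hT hc hq) k

theorem gapD_eq_zero (hn : 2 ≤ n) (hU : DAdm n U) (hT : T ⊂ U) (hc : T.card ≤ n - 2)
    (hq : q ∈ U \ T) {i j : ℕ} (hij : (U \ T).card ≤ i + j) :
    tauD n T * tauD n U * psiM U ^ i * psiP T q ^ j = 0 := by
  have hqU := (Finset.mem_sdiff.1 hq).1
  have h := (permRel_xD hn hU).gap_eq_zero (xD_empty hn) hT hqU hq hij
  rw [xD_of_card (by omega)] at h
  have h1 := tauD_mul_psiP_pow hn hU hT hc hq j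
  have h2 := mul_pow_congr (tauD_mul_psiM hn hU hqU) i
  linear_combination h + tauD n T * psiM U ^ i * h1 + tauD n T * psiUp (xD U) T U q ^ j * h2

theorem gapD_eq (hn : 2 ≤ n) (hU : DAdm n U) (hT : T ⊂ U) (hc : T.card ≤ n - 2)
    (hq : q ∈ U \ T) {i j : ℕ} (hij : i + j + 1 = (U \ T).card) :
    pD T * tauD n U * psiM U ^ i * psiP T q ^ j = ((U \ T).card - 1).choose i * pD U := by
  have hqU := (Finset.mem_sdiff.1 hq).1
  have h1 := tauD_mul_psiP_pow hn hU hT hc hq j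
  have h2 := mul_pow_congr (tauD_mul_psiM hn hU hqU) i
  have hr : ∃ r, T.Nonempty → r ∈ T := by
    rcases T.eq_empty_or_nonempty with rfl | ⟨r, hr⟩
    · exact ⟨q, fun h => absurd rfl h.ne_empty⟩
    · exact ⟨r, fun _ => hr⟩
  obtain ⟨r, hr⟩ := hr
  have h := (permRel_xD hn hU).gap_eq (xD_empty hn) hT hqU hq hr hij
  rw [xD_of_card (by omega), psiLow_xD_congr T (by omega), ← pD_eq hn hU hqU] at h
  have h3 : pD T = tauD n T * psiLow (xD T) ∅ T r ^ (T.card - 1) := by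
    rcases T.eq_empty_or_nonempty with rfl | hne
    · simp [pD]
    · exact pD_eq hn (dAdm_of_ssubset hU hT hc hne) (hr hne)
  rw [h3]
  linear_combination h + tauD n T * psiLow (xD T) ∅ T r ^ (T.card - 1) * psiM U ^ i * h1 +
    tauD n T * psiLow (xD T) ∅ T r ^ (T.card - 1) * psiUp (xD U) T U q ^ j * h2

theorem tauD_mul_psiP_congr (hn : 2 ≤ n) (hU : DAdm n U) (hT : T ⊂ U) (hc : T.card ≤ n - 2)
    (hq : q ∈ U \ T) (hr : r ∈ U \ T) :
    tauD n T * tauD n U * psiP T q = tauD n T * tauD n U * psiP T r := by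
  have h := ((permRel_xD hn hU).upper_of_ssubset (xD_empty hn) hT).up_congr hq hr
  rw [xD_of_card (by omega)] at h
  linear_combination h + tauD n T * tauD_mul_psiP hn hU hT hc hq -
    tauD n T * tauD_mul_psiP hn hU hT hc hr

theorem erase_mem_Ioo (hn : 2 ≤ n) (hc : F.card = n) (hr : r ∈ F) :
    F.erase r ∈ Finset.Ioo ∅ F := by
  refine Finset.mem_Ioo.2 ⟨?_, Finset.erase_ssubset hr⟩
  refine Finset.empty_ssubset.2 (Finset.card_pos.1 ?_)
  rw [Finset.card_erase_of_mem hr]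
  omega

theorem xD_erase (hc : F.card = n) (hr : r ∈ F) : xD F (F.erase r) = tauD n (flipD F r) := by
  rw [xD, liftD_erase hc hr]

theorem negPM_mem_flipD : negPM r ∈ flipD F r := Finset.mem_insert_self _ _

theorem erase_flipD (hF : DAdm n F) (hr : r ∈ F) : (flipD F r).erase (negPM r) = F.erase r :=
  Finset.erase_insert fun h => hF.2.1 r hr (Finset.mem_of_mem_erase h)

theorem flipD_flipD (hF : DAdm n F) (hr : r ∈ F) : flipD (flipD F r) (negPM r) = F := by
  rw [flipD, erase_flipD hF hr, negPM_negPM, Finset.insert_erase hr]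

theorem pD_eq_erase (hn : 2 ≤ n) (hF : DAdm n F) (hc : F.card = n) (hr : r ∈ F)
    (hp : p ∈ F.erase r) :
    pD F = tauD n F * tauD n (flipD F r) * psiLow (xD F) ∅ (F.erase r) p ^ (n - 2) := by
  have hr' : r ∈ F \ F.erase r := by simp [hr]
  have h := (permRel_xD hn hF).low_pow_trans (erase_mem_Ioo hn hc hr) (p := p) (p' := r) (p'' := r)
    (by simpa using hp) hr' (by simpa using hr)
  rw [xD_erase hc hr, Finset.sdiff_erase hr] at h
  simp only [Finset.sdiff_empty, Finset.sdiff_self, Finset.card_erase_of_mem hr, hc,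
    insert_empty_eq, Finset.card_singleton, Nat.sub_self, pow_zero, mul_one] at h
  rw [pD_eq hn hF hr, hc, ← h]
  congr 2

theorem pD_flipD (hn : 2 ≤ n) (hF : DAdm n F) (hc : F.card = n) (hr : r ∈ F) :
    pD (flipD F r) = pD F := by
  have h1 := erase_mem_Ioo hn hc hr
  obtain ⟨p, hp⟩ := Finset.empty_ssubset.1 (Finset.mem_Ioo.1 h1).1
  have h2 : (F.erase r).card = n - 1 := by rw [Finset.card_erase_of_mem hr, hc]
  rw [pD_eq_erase hn hF hc hr hp, pD_eq_erase hn (hF.flipD hc hr) (hF.card_flipD hc hr)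
    negPM_mem_flipD (p := p) (by rwa [erase_flipD hF hr]), erase_flipD hF hr, flipD_flipD hF hr,
    psiLow_xD_congr F h2.le, mul_comm (tauD n _)]

theorem dAdm_fullPlus (hn : 2 ≤ n) : DAdm n (fullPlus n) ∧ (fullPlus n).card = n := by
  have hc : (fullPlus n).card = n := by
    have : fullPlus n = (Finset.univ : Finset (Fin n)).image (fun k => (k, true)) := by
      ext ⟨a, b⟩
      cases b <;> simp [fullPlus]
    rw [this, Finset.card_image_of_injective _ (fun a b h => (Prod.mk.inj h).1)]
    simp
  refine ⟨⟨Finset.card_pos.1 (by omega), ?_, by omega⟩, hc⟩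
  rintro ⟨a, b⟩ h
  simp_all [fullPlus, negPM]

theorem fullMinus_eq (hn : 2 ≤ n) :
    fullMinus n = flipD (fullPlus n) (⟨n - 1, by omega⟩, true) := by
  ext ⟨a, b⟩
  have := a.2
  cases b
  · simp [fullMinus, flipD, fullPlus, negPM, Fin.ext_iff]
  · simp [fullMinus, flipD, fullPlus, negPM, Fin.ext_iff]
    omega

theorem erase_fullPlus (hn : 2 ≤ n) :
    (fullPlus n).erase (⟨n - 1, by omega⟩, true) = initSegD n (n - 1) := by
  ext ⟨a, b⟩
  have := a.2
  cases b
  · simp [initSegD, fullPlus]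
  · simp [initSegD, fullPlus, Fin.ext_iff]
    omega

theorem card_initSegD {k : ℕ} (hk : k ≤ n) : (initSegD n k).card = k := by
  have : initSegD n k = (Finset.univ : Finset (Fin k)).image (fun a => (Fin.castLE hk a, true)) := by
    ext ⟨a, b⟩
    simp only [initSegD, Finset.mem_filter, Finset.mem_univ, true_and, Finset.mem_image,
      Prod.mk.injEq]
    constructor
    · rintro ⟨rfl, h⟩
      exact ⟨⟨a, h⟩, rfl, rfl⟩
    · rintro ⟨x, rfl, rfl⟩
      exact ⟨rfl, x.2⟩
  rw [this, Finset.card_image_of_injective]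
  · simp
  · intro a b h
    exact Fin.castLE_injective hk (Prod.mk.inj h).1

theorem initSegD_mem_Ioo {k : ℕ} (h1 : 1 ≤ k) (h2 : k + 1 ≤ n) :
    initSegD n k ∈ Finset.Ioo ∅ (initSegD n (k + 1)) := by
  have e1 := card_initSegD (n := n) (k := k) (by omega)
  have e2 := card_initSegD h2
  refine Finset.mem_Ioo.2 ⟨Finset.empty_ssubset.2 (Finset.card_pos.1 (by omega)), ?_⟩
  refine Finset.ssubset_iff_subset_ne.2 ⟨?_, fun h => ?_⟩
  · intro a
    simp only [initSegD, Finset.mem_filter, Finset.mem_univ, true_and]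
    exact fun h => ⟨h.1, by omega⟩
  · rw [h] at e1
    omega

theorem pD_fullPlus (hn : 2 ≤ n) : pD (fullPlus n) = ptD n := by
  obtain ⟨hP, hc⟩ := dAdm_fullPlus hn
  set l : PM n := (⟨n - 1, by omega⟩, true) with hl
  have hlP : l ∈ fullPlus n := by simp [fullPlus, hl]
  have hmem : ∀ k, 1 ≤ k → ((⟨0, by omega⟩, true) : PM n) ∈ initSegD n k := by
    intro k hk
    simp only [initSegD, Finset.mem_filter, Finset.mem_univ, true_and]
    omega
  have key : ∀ j, j + 2 ≤ n →
      PermRel (xD (fullPlus n)) (tauD n (fullPlus n) * tauD n (fullMinus n) *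
        ∏ i ∈ Finset.Ico (n - 1 - j) (n - 1), tauD n (initSegD n i)) ∅ (initSegD n (n - 1 - j)) ∧
      pD (fullPlus n) = tauD n (fullPlus n) * tauD n (fullMinus n) *
        (∏ i ∈ Finset.Ico (n - 1 - j) (n - 1), tauD n (initSegD n i)) *
        psiLow (xD (fullPlus n)) ∅ (initSegD n (n - 1 - j)) (⟨0, by omega⟩, true) ^
          (n - 1 - j - 1) := by
    intro j
    induction j with
    | zero =>
      intro _
      have h0 := erase_fullPlus hn
      have h1 := (permRel_xD hn hP).lower (erase_mem_Ioo hn hc hlP)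
      rw [xD_erase hc hlP, ← fullMinus_eq hn, h0] at h1
      have h2 := pD_eq_erase hn hP hc hlP (p := (⟨0, by omega⟩, true))
        (by rw [h0]; exact hmem _ (by omega))
      rw [← fullMinus_eq hn, h0] at h2
      simp only [Nat.sub_zero, Finset.Ico_self, Finset.prod_empty, mul_one]
      exact ⟨h1, h2⟩
    | succ j ih =>
      intro hj
      obtain ⟨ih1, ih2⟩ := ih (by omega)
      obtain ⟨k, hk⟩ : ∃ k, n - 1 - j = k + 1 := ⟨n - 1 - (j + 1), by omega⟩
      have hk' : n - 1 - (j + 1) = k := by omega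
      rw [hk] at ih1 ih2
      rw [hk']
      have hI := initSegD_mem_Ioo (n := n) (k := k) (by omega) (by omega)
      have hck := card_initSegD (n := n) (k := k) (by omega)
      have hck' := card_initSegD (n := n) (k := k + 1) (by omega)
      have hprod : ∏ i ∈ Finset.Ico k (n - 1), tauD n (initSegD n i) =
          (∏ i ∈ Finset.Ico (k + 1) (n - 1), tauD n (initSegD n i)) *
            xD (fullPlus n) (initSegD n k) := by
        rw [xD_of_card (by omega), Finset.prod_eq_prod_Ico_succ_bot (by omega), mul_comm]
      have hs := card_sdiff_add_of_mem_Ioo hI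
      obtain ⟨a, ha⟩ := Finset.card_pos.1 hs.2.1
      rw [hprod, ← mul_assoc]
      refine ⟨ih1.lower hI, ?_⟩
      have h := ih1.low_pow_trans hI (p := (⟨0, by omega⟩, true))
        (p'' := (⟨0, by omega⟩, true)) (by simpa using hmem k (by omega)) ha
        (by simpa using hmem (k + 1) (by omega))
      simp only [Finset.sdiff_empty, hck, hck'] at h hs
      rw [ih2, ← h, show (initSegD n (k + 1) \ initSegD n k).card - 1 = 0 by omega, pow_zero,
        mul_one]
  have h := (key (n - 2) (by omega)).2
  rw [show n - 1 - (n - 2) = 1 by omega, Nat.sub_self, pow_zero, mul_one] at h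
  rw [h, ptD, show Finset.Icc 1 (n - 2) = Finset.Ico 1 (n - 1) by ext; simp; omega]
  ring

theorem pD_full (hn : 2 ≤ n) : ∀ {F : Finset (PM n)}, DAdm n F → F.card = n → pD F = ptD n := by
  suffices H : ∀ k, ∀ F : Finset (PM n), DAdm n F → F.card = n → negCount F = k → pD F = ptD n from
    fun {_} hF hc => H _ _ hF hc rfl
  intro k
  induction k with
  | zero =>
    intro F hF hc h
    have hsub : F ⊆ fullPlus n := by
      intro a ha
      have : F.filter (fun p => p.2 = false) = ∅ := Finset.card_eq_zero.1 h
      have := Finset.filter_eq_empty_iff.1 this ha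
      simpa [fullPlus] using this
    rw [Finset.eq_of_subset_of_card_le hsub (by rw [(dAdm_fullPlus hn).2, hc]), pD_fullPlus hn]
  | succ k ih =>
    intro F hF hc h
    obtain ⟨r, hr⟩ := Finset.card_pos.1 (show 0 < (F.filter (fun p => p.2 = false)).card by
      rw [negCount] at h; omega)
    obtain ⟨hrF, hr2⟩ := Finset.mem_filter.1 hr
    rw [← pD_flipD hn hF hc hrF]
    refine ih _ (hF.flipD hc hrF) (hF.card_flipD hc hrF) ?_
    have : (flipD F r).filter (fun p => p.2 = false) = (F.filter (fun p => p.2 = false)).erase r := by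
      rw [flipD, Finset.filter_insert, if_neg (by simp [negPM, hr2]), Finset.filter_erase]
    rw [negCount, this, Finset.card_erase_of_mem hr]
    rw [negCount] at h
    omega

end Gap

section TopValue

variable {n : ℕ} {p q r : PM n} {A S T U F : Finset (PM n)}

theorem card_sdiff_erase (hr : r ∈ F) (hrT : r ∉ T) : (F.erase r \ T).card + 1 = (F \ T).card := by
  have h : F.erase r \ T = (F \ T).erase r := by
    ext a
    simp only [Finset.mem_sdiff, Finset.mem_erase]
    tauto
  have hm : r ∈ F \ T := Finset.mem_sdiff.2 ⟨hr, hrT⟩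
  rw [h, Finset.card_erase_of_mem hm]
  have := Finset.card_pos.2 ⟨r, hm⟩
  omega

theorem ssubset_erase (hc : F.card = n) (hr : r ∈ F) (hT : T ⊂ F) (hcT : T.card ≤ n - 2)
    (hn : 2 ≤ n) (hrT : r ∉ T) : T ⊂ F.erase r := by
  refine Finset.ssubset_iff_subset_ne.2 ⟨Finset.subset_erase.2 ⟨hT.1, hrT⟩, fun h => ?_⟩
  have := Finset.card_erase_of_mem hr
  rw [← h] at this
  omega

theorem tauD_mul_psiP_erase (hn : 2 ≤ n) (hF : DAdm n F) (hc : F.card = n) (hr : r ∈ F)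
    (hT : T ⊂ F) (hcT : T.card ≤ n - 2) (hrT : r ∉ T) (hq : q ∈ F \ T) (hp : p ∈ F.erase r \ T) :
    tauD n T * tauD n F * tauD n (flipD F r) * psiP T q =
      tauD n T * tauD n F * tauD n (flipD F r) * psiUp (xD F) T (F.erase r) p := by
  have hTG := ssubset_erase hc hr hT hcT hn hrT
  have hpF := Finset.sdiff_subset_sdiff (Finset.erase_subset r F) (Finset.Subset.refl T) hp
  have h1 := tauD_mul_psiP_congr hn hF hT hcT hq hpF
  have h2 := ((permRel_xD hn hF).upper_of_ssubset (xD_empty hn) hT).up_restrict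
    (Finset.mem_Ioo.2 ⟨hTG, Finset.erase_ssubset hr⟩) hp
  rw [xD_of_card (A := T) (by omega), xD_erase hc hr] at h2
  have h3 := tauD_mul_psiP hn hF hT hcT hpF
  linear_combination tauD n (flipD F r) * h1 + h2 + tauD n T * tauD n (flipD F r) * h3

theorem pow_mul_pow_flipD (hn : 2 ≤ n) (hF : DAdm n F) (hc : F.card = n) (hr : r ∈ F)
    (hp : p ∈ F.erase r) (x y : ℕ) :
    tauD n F ^ (x + 1) * tauD n (flipD F r) ^ (y + 1) =
      tauD n F * tauD n (flipD F r) *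
        ((-1) ^ (x + y) * psiLow (xD F) ∅ (F.erase r) p ^ (x + y)) := by
  have h2 : (F.erase r).card = n - 1 := by rw [Finset.card_erase_of_mem hr, hc]
  have e1 := (permRel_xD hn hF).mul_sq_coatom hr (erase_mem_Ioo hn hc hr) (p := p) (by simpa using hp)
  rw [xD_erase hc hr] at e1
  have e2 := (permRel_xD hn (hF.flipD hc hr)).mul_sq_coatom (U := flipD F r) (r := negPM r)
    (p := p) negPM_mem_flipD (erase_mem_Ioo hn (hF.card_flipD hc hr) negPM_mem_flipD)
    (by simpa [erase_flipD hF hr] using hp)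
  rw [xD_erase (hF.card_flipD hc hr) negPM_mem_flipD, flipD_flipD hF hr, erase_flipD hF hr,
    psiLow_xD_congr F h2.le] at e2
  induction x with
  | zero =>
    induction y with
    | zero => simp
    | succ y ih =>
      simp only [zero_add] at ih ⊢
      rw [pow_succ _ (y + 1), ← mul_assoc, ih]
      linear_combination (-1) ^ y * psiLow (xD F) ∅ (F.erase r) p ^ y * e1
  | succ x ih =>
    rw [pow_succ, mul_right_comm, ih]
    linear_combination (-1) ^ (x + y) * psiLow (xD F) ∅ (F.erase r) p ^ (x + y) * e2

theorem gap_opposite_eq_zero (hn : 2 ≤ n) (hF : DAdm n F) (hc : F.card = n) (hr : r ∈ F)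
    (hT : T ⊂ F) (hcT : T.card ≤ n - 2) (hrT : r ∉ T) (hq : q ∈ F \ T) {k x y : ℕ}
    (hk : (F \ T).card < k + (x + y + 2)) :
    tauD n T * psiP T q ^ k * (tauD n F ^ (x + 1) * tauD n (flipD F r) ^ (y + 1)) = 0 := by
  have hTG := ssubset_erase hc hr hT hcT hn hrT
  have hcard := card_sdiff_erase hr hrT
  obtain ⟨p, hpF, hpT⟩ := Finset.exists_of_ssubset hTG
  have hp : p ∈ F.erase r \ T := Finset.mem_sdiff.2 ⟨hpF, hpT⟩
  have h := ((permRel_xD hn hF).lower (erase_mem_Ioo hn hc hr)).gap_eq_zero (xD_empty hn) hTG hpF hp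
    (i := x + y) (j := k) (by omega)
  rw [xD_erase hc hr, xD_of_card (by omega)] at h
  have h2 := mul_pow_congr (tauD_mul_psiP_erase hn hF hc hr hT hcT hrT hq hp) k
  rw [pow_mul_pow_flipD hn hF hc hr hpF]
  linear_combination (-1) ^ (x + y) * h +
    (-1) ^ (x + y) * psiLow (xD F) ∅ (F.erase r) p ^ (x + y) * h2

theorem gap_opposite_eq (hn : 2 ≤ n) (hF : DAdm n F) (hc : F.card = n) (hr : r ∈ F)
    (hT : T ⊂ F) (hcT : T.card ≤ n - 2) (hrT : r ∉ T) (hq : q ∈ F \ T) {k x y : ℕ}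
    (hk : k + (x + y + 2) = (F \ T).card) :
    pD T * psiP T q ^ k * (tauD n F ^ (x + 1) * tauD n (flipD F r) ^ (y + 1)) =
      (((-1) ^ (x + y) * (((F \ T).card - 2).choose (x + y) : ℕ) : ℤ) : RD n) * ptD n := by
  have hTG := ssubset_erase hc hr hT hcT hn hrT
  have hcard := card_sdiff_erase hr hrT
  obtain ⟨p, hpF, hpT⟩ := Finset.exists_of_ssubset hTG
  have hp : p ∈ F.erase r \ T := Finset.mem_sdiff.2 ⟨hpF, hpT⟩
  have hs : ∃ s, T.Nonempty → s ∈ T := by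
    rcases T.eq_empty_or_nonempty with rfl | ⟨r, hr⟩
    · exact ⟨q, fun h => absurd rfl h.ne_empty⟩
    · exact ⟨r, fun _ => hr⟩
  obtain ⟨s, hs⟩ := hs
  have h := ((permRel_xD hn hF).lower (erase_mem_Ioo hn hc hr)).gap_eq (xD_empty hn) hTG hpF hp hs
    (i := x + y) (j := k) (by omega)
  have hG : (F.erase r).card - 1 = n - 2 := by rw [Finset.card_erase_of_mem hr, hc]; omega
  rw [xD_erase hc hr, xD_of_card (by omega), psiLow_xD_congr T (by omega), hG,
    ← pD_eq_erase hn hF hc hr hpF, pD_full hn hF hc,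
    show (F.erase r \ T).card - 1 = (F \ T).card - 2 by omega] at h
  have h3 : pD T = tauD n T * psiLow (xD T) ∅ T s ^ (T.card - 1) := by
    rcases T.eq_empty_or_nonempty with rfl | hne
    · simp [pD]
    · exact pD_eq hn (dAdm_of_ssubset hF hT hcT hne) (hs hne)
  have h2 := mul_pow_congr (tauD_mul_psiP_erase hn hF hc hr hT hcT hrT hq hp) k
  rw [pow_mul_pow_flipD hn hF hc hr hpF, h3]
  push_cast
  linear_combination (-1) ^ (x + y) * h + psiLow (xD T) ∅ T s ^ (T.card - 1) *
    (-1) ^ (x + y) * psiLow (xD F) ∅ (F.erase r) p ^ (x + y) * h2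

theorem tauD_mul_flipD_mul_flipD (hF : DAdm n F) (hc : F.card = n) (hq : q ∈ F) (hr : r ∈ F)
    (hqr : q ≠ r) : tauD n (flipD F q) * tauD n (flipD F r) = 0 := by
  have h0 : 2 ≤ F.card := Finset.one_lt_card.2 ⟨q, hq, r, hr, hqr⟩
  have hi : flipD F q ∩ flipD F r = (F.erase q).erase r := by
    ext a
    have h1 := hF.2.1 q hq
    have h2 := hF.2.1 r hr
    simp only [flipD, Finset.mem_inter, Finset.mem_insert, Finset.mem_erase]
    constructor
    · rintro ⟨rfl | h, h' | h'⟩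
      · exact absurd (negPM_injective h') hqr
      · exact absurd h'.2 h1
      · exact absurd (h' ▸ h.2) h2
      · exact ⟨h'.1, h⟩
    · rintro ⟨h, h'⟩
      exact ⟨Or.inr h', Or.inr ⟨h, h'.2⟩⟩
  have hci : (flipD F q ∩ flipD F r).card = n - 2 := by
    rw [hi, Finset.card_erase_of_mem (Finset.mem_erase.2 ⟨hqr.symm, hr⟩),
      Finset.card_erase_of_mem hq, hc]
    rfl
  refine tauD_mul_eq_zero (hF.flipD hc hq) (hF.flipD hc hr) ?_
  have e1 := hF.card_flipD hc hq
  have e2 := hF.card_flipD hc hr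
  rintro (h | h | h)
  · rw [Finset.inter_eq_left.2 h] at hci
    omega
  · rw [Finset.inter_eq_right.2 h] at hci
    omega
  · omega

theorem tauD_mul_flipD_mul_psiM (hn : 2 ≤ n) (hF : DAdm n F) (hc : F.card = n) (hr : r ∈ F) :
    tauD n F * tauD n (flipD F r) * psiM F = 0 := by
  have hr' : r ∈ F \ F.erase r := by simp [hr]
  have h1 : F \ F.erase r = {r} := by
    rw [Finset.sdiff_erase hr]
    simp
  have hG := erase_mem_Ioo hn hc hr
  have h2 := ((permRel_xD hn hF).upper hG).low_pow_mul_up_pow_eq_zero hr' hr' (i := 1) (j := 0)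
    (by simp [h1])
  rw [pow_one, pow_zero, mul_one, ← (permRel_xD hn hF).low_restrict hG hr', xD_erase hc hr] at h2
  linear_combination h2 + tauD n (flipD F r) * tauD_mul_psiM hn hF hr

theorem tauD_pow_of_full (hn : 2 ≤ n) (hF : DAdm n F) (hc : F.card = n) (m : ℕ) :
    tauD n F ^ (m + 2) = (-2) ^ (m + 1) * (tauD n F * psiM F ^ (m + 1)) +
      ∑ r ∈ F, tauD n F * tauD n (flipD F r) ^ (m + 1) := by
  obtain ⟨p, hp⟩ := hF.1
  have hsq : tauD n F * tauD n F =
      tauD n F * (∑ r ∈ F, tauD n (flipD F r)) - 2 * (tauD n F * psiM F) := by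
    rw [tauD_mul_psiM hn hF hp, tauD_sq_of_full hn hF hc hp]
    ring
  induction m with
  | zero =>
    simp only [zero_add, pow_one]
    rw [pow_two, hsq, Finset.mul_sum]
    ring
  | succ m ih =>
    have h1 : tauD n F * (∑ r ∈ F, tauD n (flipD F r)) * psiM F = 0 := by
      rw [Finset.mul_sum, Finset.sum_mul]
      exact Finset.sum_eq_zero fun r hr => tauD_mul_flipD_mul_psiM hn hF hc hr
    have h2 : ∀ r ∈ F, tauD n F * tauD n F * tauD n (flipD F r) ^ (m + 1) =
        tauD n F * tauD n (flipD F r) ^ (m + 2) := by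
      intro r hr
      have h3 : (∑ s ∈ F, tauD n (flipD F s)) * tauD n (flipD F r) = tauD n (flipD F r) ^ 2 := by
        rw [Finset.sum_mul, Finset.sum_eq_single_of_mem r hr, pow_two]
        exact fun s hs hsr => tauD_mul_flipD_mul_flipD hF hc hs hr hsr
      have h4 := tauD_mul_flipD_mul_psiM hn hF hc hr
      rw [hsq, pow_succ]
      linear_combination tauD n F * tauD n (flipD F r) ^ m * h3 -
        2 * tauD n (flipD F r) ^ m * h4
    rw [show m + 1 + 2 = (m + 2) + 1 by ring, pow_succ, ih, add_mul, Finset.sum_mul]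
    rw [Finset.sum_congr rfl (fun r hr => by
      rw [mul_right_comm, h2 r hr] : ∀ r ∈ F, tauD n F * tauD n (flipD F r) ^ (m + 1) * tauD n F =
        tauD n F * tauD n (flipD F r) ^ (m + 2))]
    rw [add_left_inj]
    linear_combination (-2) ^ (m + 1) * psiM F ^ (m + 1) * hsq +
      (-2) ^ (m + 1) * psiM F ^ m * h1

/-- The product `R` of `ρ` classes of sets above `T` vanishes in excess degree, and evaluates to
`v` in complementary degree. -/
def TopVal (T : Finset (PM n)) (ρ : ℕ) (R : RD n) (v : ℤ) : Prop :=
  ∃ q, q ∉ T ∧ negPM q ∉ T ∧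
    (∀ k, n < T.card + (k + ρ) → tauD n T * psiP T q ^ k * R = 0) ∧
    (∀ k, T.card + (k + ρ) = n → pD T * psiP T q ^ k * R = (v : RD n) * ptD n)

theorem topVal_opposite (hn : 2 ≤ n) (hF : DAdm n F) (hc : F.card = n) (hr : r ∈ F)
    (hT : T ⊂ F) (hcT : T.card ≤ n - 2) (hrT : r ∉ T) (x y : ℕ) :
    TopVal T (x + y + 2) (tauD n F ^ (x + 1) * tauD n (flipD F r) ^ (y + 1))
      ((-1) ^ (x + y) * ((n - T.card - 2).choose (x + y) : ℕ)) := by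
  obtain ⟨q, hqF, hqT⟩ := Finset.exists_of_ssubset hT
  have hq : q ∈ F \ T := Finset.mem_sdiff.2 ⟨hqF, hqT⟩
  have h1 : (F \ T).card = n - T.card := by rw [Finset.card_sdiff_of_subset hT.1, hc]
  refine ⟨q, hqT, fun h => hF.2.1 q hqF (hT.1 h), fun k hk => ?_, fun k hk => ?_⟩
  · exact gap_opposite_eq_zero hn hF hc hr hT hcT hrT hq (by omega)
  · rw [gap_opposite_eq hn hF hc hr hT hcT hrT hq (by omega), h1]

theorem topVal_one (hn : 2 ≤ n) (hF : DAdm n F) (hc : F.card = n) (hT : T ⊂ F)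
    (hcT : T.card ≤ n - 2) : TopVal T 1 (tauD n F) 1 := by
  obtain ⟨q, hqF, hqT⟩ := Finset.exists_of_ssubset hT
  have hq : q ∈ F \ T := Finset.mem_sdiff.2 ⟨hqF, hqT⟩
  have h1 : (F \ T).card = n - T.card := by rw [Finset.card_sdiff_of_subset hT.1, hc]
  refine ⟨q, hqT, fun h => hF.2.1 q hqF (hT.1 h), fun k hk => ?_, fun k hk => ?_⟩
  · have := gapD_eq_zero hn hF hT hcT hq (i := 0) (j := k) (by omega)
    linear_combination this
  · have := gapD_eq hn hF hT hcT hq (i := 0) (j := k) (by omega)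
    rw [pD_full hn hF hc, Nat.choose_zero_right] at this
    push_cast at this ⊢
    linear_combination this

theorem tauD_mul_flipD_eq_zero (hn : 2 ≤ n) (hF : DAdm n F) (hc : F.card = n) (hT : T ⊂ F)
    (hcT : T.card ≤ n - 2) (hr : r ∈ T) : tauD n T * tauD n (flipD F r) = 0 := by
  have hrF := hT.1 hr
  have hc' := hF.card_flipD hc hrF
  refine tauD_mul_eq_zero (dAdm_of_ssubset hF hT hcT ⟨r, hr⟩) (hF.flipD hc hrF) ?_
  rintro (h | h | h)
  · exact (hF.flipD hc hrF).2.1 r (h hr) negPM_mem_flipD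
  · have := Finset.card_le_card h
    omega
  · omega

theorem topVal_same (hn : 2 ≤ n) (hF : DAdm n F) (hc : F.card = n) (hT : T ⊂ F)
    (hcT : T.card ≤ n - 2) (m : ℕ) :
    TopVal T (m + 2) (tauD n F ^ (m + 2))
      ((-2) ^ (m + 1) * ((n - T.card - 1).choose (m + 1) : ℕ) +
        (n - T.card : ℕ) * ((-1) ^ m * ((n - T.card - 2).choose m : ℕ))) := by
  obtain ⟨q, hqF, hqT⟩ := Finset.exists_of_ssubset hT
  have hq : q ∈ F \ T := Finset.mem_sdiff.2 ⟨hqF, hqT⟩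
  have h1 : (F \ T).card = n - T.card := by rw [Finset.card_sdiff_of_subset hT.1, hc]
  refine ⟨q, hqT, fun h => hF.2.1 q hqF (hT.1 h), fun k hk => ?_, fun k hk => ?_⟩
  · rw [tauD_pow_of_full hn hF hc, mul_add, Finset.mul_sum]
    rw [Finset.sum_eq_zero, add_zero]
    · have := gapD_eq_zero hn hF hT hcT hq (i := m + 1) (j := k) (by omega)
      linear_combination (-2) ^ (m + 1) * this
    · intro r hr
      by_cases hrT : r ∈ T
      · have := tauD_mul_flipD_eq_zero hn hF hc hT hcT hrT
        rw [pow_succ]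
        linear_combination psiP T q ^ k * tauD n F * tauD n (flipD F r) ^ m * this
      · have := gap_opposite_eq_zero hn hF hc hr hT hcT hrT hq (k := k) (x := 0) (y := m) (by omega)
        simpa using this
  · rw [tauD_pow_of_full hn hF hc, mul_add, Finset.mul_sum]
    have e1 := gapD_eq hn hF hT hcT hq (i := m + 1) (j := k) (by omega)
    rw [pD_full hn hF hc, h1] at e1
    have e2 : ∑ r ∈ F, pD T * psiP T q ^ k * (tauD n F * tauD n (flipD F r) ^ (m + 1)) =
        ∑ r ∈ F \ T,
          (((-1) ^ m * ((n - T.card - 2).choose m : ℕ) : ℤ) : RD n) * ptD n := by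
      rw [← Finset.sum_subset (Finset.sdiff_subset (s := F) (t := T))]
      · refine Finset.sum_congr rfl fun r hr => ?_
        obtain ⟨hr, hrT⟩ := Finset.mem_sdiff.1 hr
        have := gap_opposite_eq hn hF hc hr hT hcT hrT hq (k := k) (x := 0) (y := m) (by omega)
        rw [h1] at this
        simpa using this
      · intro r hr hrT
        have hrT : r ∈ T := by simpa [hr] using hrT
        have := tauD_mul_flipD_eq_zero hn hF hc hT hcT hrT
        rw [pow_succ, pD]
        linear_combination psiM T ^ (T.card - 1) * psiP T q ^ k * tauD n F *
          tauD n (flipD F r) ^ m * this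
    rw [e2, Finset.sum_const, h1, nsmul_eq_mul]
    push_cast
    linear_combination (-2) ^ (m + 1) * e1

end TopValue

section Step

variable {n : ℕ} {p q r : PM n} {A S T U F : Finset (PM n)}

theorem exists_notMem_fst (hU : U.card < n) : ∃ k : Fin n, k ∉ U.image Prod.fst := by
  by_contra! h
  have h1 : U.image Prod.fst = Finset.univ := Finset.eq_univ_iff_forall.2 h
  have h2 := Finset.card_image_le (s := U) (f := Prod.fst)
  rw [h1, Finset.card_univ, Fintype.card_fin] at h2
  omega

theorem notMem_of_fst {k : Fin n} (hk : k ∉ U.image Prod.fst) (b : Bool) : (k, b) ∉ U :=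
  fun h => hk (Finset.mem_image_of_mem Prod.fst h)

theorem card_full_supersets (hn : 2 ≤ n) (m : ℕ) :
    ∀ W : Finset (PM n), (∀ p ∈ W, negPM p ∉ W) → W.card + m = n →
      ((admSets n).filter (fun S => W ⊆ S ∧ S.card = n)).card = 2 ^ m := by
  induction m with
  | zero =>
    intro W hW hc
    have : (admSets n).filter (fun S => W ⊆ S ∧ S.card = n) = {W} := by
      ext S
      simp only [Finset.mem_filter, mem_admSets, Finset.mem_singleton]
      constructor
      · rintro ⟨-, h1, h2⟩
        exact (Finset.eq_of_subset_of_card_le h1 (by omega)).symm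
      · rintro rfl
        exact ⟨⟨Finset.card_pos.1 (by omega), hW, by omega⟩, subset_rfl, by omega⟩
    rw [this, Finset.card_singleton, pow_zero]
  | succ m ih =>
    intro W hW hc
    obtain ⟨k, hk⟩ := exists_notMem_fst (U := W) (by omega)
    have hk' := notMem_of_fst hk
    have hins : ∀ b, ((admSets n).filter (fun S => insert (k, b) W ⊆ S ∧ S.card = n)).card =
        2 ^ m := by
      intro b
      refine ih _ ?_ ?_
      · intro p hp hp'
        rw [Finset.mem_insert] at hp hp'
        rcases hp with rfl | hp <;> rcases hp' with hp' | hp'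
        · exact negPM_ne _ hp'
        · exact hk' _ hp'
        · rw [← negPM_negPM p, hp'] at hp
          exact hk' _ hp
        · exact hW p hp hp'
      · rw [Finset.card_insert_of_notMem (hk' b)]
        omega
    have hunion : (admSets n).filter (fun S => W ⊆ S ∧ S.card = n) =
        (admSets n).filter (fun S => insert (k, true) W ⊆ S ∧ S.card = n) ∪
          (admSets n).filter (fun S => insert (k, false) W ⊆ S ∧ S.card = n) := by
      ext S
      simp only [Finset.mem_filter, mem_admSets, Finset.mem_union, Finset.insert_subset_iff]
      constructor
      · rintro ⟨hS, h1, h2⟩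
        rcases hS.mem_or_neg_mem h2 (k, true) with h | h
        · exact Or.inl ⟨hS, ⟨h, h1⟩, h2⟩
        · exact Or.inr ⟨hS, ⟨h, h1⟩, h2⟩
      · rintro (⟨hS, ⟨_, h1⟩, h2⟩ | ⟨hS, ⟨_, h1⟩, h2⟩) <;> exact ⟨hS, h1, h2⟩
    rw [hunion, Finset.card_union_of_disjoint, hins, hins, pow_succ, mul_two]
    rw [Finset.disjoint_left]
    intro S h1 h2
    rw [Finset.mem_filter, mem_admSets] at h1 h2
    exact h1.1.2.1 (k, true) (h1.2.1 (Finset.mem_insert_self _ _))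
      (h2.2.1 (Finset.mem_insert_self _ _))

theorem tauD_mul_psiP_congr_of_notMem (hn : 2 ≤ n) (hU : DAdm n U) (hc : U.card ≤ n - 2)
    (hq : q ∉ U) (hq' : negPM q ∉ U) (hr : r ∉ U) (hr' : negPM r ∉ U) :
    tauD n U * psiP U q = tauD n U * psiP U r := by
  obtain ⟨p, hp⟩ := hU.1
  linear_combination tauD_sq hn hU hc hp hq hq' - tauD_sq hn hU hc hp hr hr'

theorem tauD_mul_tauD_mul_psiP_pow (hn : 2 ≤ n) (hU : DAdm n U) (hc : U.card ≤ n - 2)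
    (hq : q ∉ U) (hq' : negPM q ∉ U) (hS : DAdm n S) (hUS : U ⊂ S) (hr : r ∈ S \ U) (k : ℕ) :
    tauD n U * psiP U q ^ k = tauD n U * psiP U r ^ k := by
  obtain ⟨hrS, hrU⟩ := Finset.mem_sdiff.1 hr
  exact mul_pow_congr (tauD_mul_psiP_congr_of_notMem hn hU hc hq hq' hrU
    (fun h => hS.2.1 r hrS (hUS.1 h))) k

theorem topVal_empty_product (hn : 2 ≤ n) (hU : DAdm n U) (hc : U.card ≤ n - 2) :
    TopVal U 0 1 (2 ^ (n - U.card - 1)) := by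
  obtain ⟨k₀, hk₀⟩ := exists_notMem_fst (U := U) (by omega)
  have hq : ((k₀, true) : PM n) ∉ U := notMem_of_fst hk₀ _
  have hq' : negPM ((k₀, true) : PM n) ∉ U := notMem_of_fst hk₀ _
  generalize ((k₀, true) : PM n) = q at hq hq'
  refine ⟨q, hq, hq', fun k hk => ?_, fun k hk => ?_⟩
  · obtain ⟨k, rfl⟩ : ∃ j, k = j + 1 := ⟨k - 1, by omega⟩
    rw [mul_one, pow_succ, psiP, Finset.mul_sum, Finset.mul_sum]
    refine Finset.sum_eq_zero fun S hS => ?_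
    rw [Finset.mem_filter, mem_admSets] at hS
    obtain ⟨hS, hUS⟩ := hS
    obtain ⟨r, hrS, hrU⟩ := Finset.exists_of_ssubset hUS
    have hr := Finset.mem_sdiff.2 ⟨hrS, hrU⟩
    have h1 := tauD_mul_tauD_mul_psiP_pow hn hU hc hq hq' hS hUS hr k
    have hcS := hS.card_le
    have h2 := gapD_eq_zero hn hS hUS hc hr (i := 0) (j := k)
      (by rw [Finset.card_sdiff_of_subset hUS.1]; omega)
    rw [← psiP]
    linear_combination (upCoeff q S : RD n) * tauD n S * h1 + (upCoeff q S : RD n) * h2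
  · obtain ⟨k, rfl⟩ : ∃ j, k = j + 1 := ⟨k - 1, by omega⟩
    have hterm : ∀ S ∈ (admSets n).filter (fun S => U ⊂ S),
        pD U * (psiP U q ^ k * ((upCoeff q S : RD n) * tauD n S)) =
          if insert (negPM q) U ⊆ S ∧ S.card = n then ptD n else 0 := by
      intro S hS
      rw [Finset.mem_filter, mem_admSets] at hS
      obtain ⟨hS, hUS⟩ := hS
      obtain ⟨r, hrS, hrU⟩ := Finset.exists_of_ssubset hUS
      have hr := Finset.mem_sdiff.2 ⟨hrS, hrU⟩
      have h1 := tauD_mul_tauD_mul_psiP_pow hn hU hc hq hq' hS hUS hr k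
      by_cases hSn : S.card = n
      · have h2 := gapD_eq hn hS hUS hc hr (i := 0) (j := k)
          (by rw [Finset.card_sdiff_of_subset hUS.1]; omega)
        rw [pD_full hn hS hSn, Nat.choose_zero_right, Nat.cast_one] at h2
        have h3 : upCoeff q S = if negPM q ∈ S then 1 else 0 := by
          rw [upCoeff, if_neg (by omega), if_pos hSn]
        rw [h3]
        simp only [Finset.insert_subset_iff, hUS.1, and_true, hSn]
        split_ifs
        · rw [pD] at h2 ⊢
          push_cast
          linear_combination h2 + psiM U ^ (U.card - 1) * tauD n S * h1
        · simp
      · rw [if_neg fun h => hSn h.2]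
        have := hS.card_le_of_ne hSn
        have h2 := gapD_eq_zero hn hS hUS hc hr (i := 0) (j := k)
          (by rw [Finset.card_sdiff_of_subset hUS.1]; omega)
        rw [pD]
        linear_combination psiM U ^ (U.card - 1) * (upCoeff q S : RD n) * tauD n S * h1 +
          psiM U ^ (U.card - 1) * (upCoeff q S : RD n) * h2
    have hfilter : ((admSets n).filter (fun S => U ⊂ S)).filter
        (fun S => insert (negPM q) U ⊆ S ∧ S.card = n) =
          (admSets n).filter (fun S => insert (negPM q) U ⊆ S ∧ S.card = n) := by
      rw [Finset.filter_filter]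
      refine Finset.filter_congr fun S _ => ⟨fun h => h.2, fun h => ⟨?_, h⟩⟩
      exact lt_of_lt_of_le (Finset.ssubset_insert hq') h.1
    have hcount := card_full_supersets hn k (insert (negPM q) U) (by
      intro p hp hp'
      rw [Finset.mem_insert] at hp hp'
      rcases hp with rfl | hp <;> rcases hp' with hp' | hp'
      · exact negPM_ne _ hp'
      · rw [negPM_negPM] at hp'
        exact hq hp'
      · exact hq (negPM_injective hp' ▸ hp)
      · exact hU.2.1 p hp hp') (by rw [Finset.card_insert_of_notMem hq']; omega)
    have hP : psiP U q =
        ∑ S ∈ (admSets n).filter (fun S => U ⊂ S), (upCoeff q S : RD n) * tauD n S := rfl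
    rw [mul_one, pow_succ]
    nth_rewrite 2 [hP]
    rw [Finset.mul_sum, Finset.mul_sum, Finset.sum_congr rfl hterm, ← Finset.sum_filter,
      hfilter, Finset.sum_const, hcount, nsmul_eq_mul, show n - U.card - 1 = k by omega]
    push_cast
    rfl

theorem tauD_pow_eq_sum (hn : 2 ≤ n) (hU : DAdm n U) (hc : U.card ≤ n - 2) (hq : q ∉ U)
    (hq' : negPM q ∉ U) (m : ℕ) :
    tauD n U ^ (m + 1) = ∑ i ∈ Finset.range (m + 1),
      (((-1) ^ m * (m.choose i : ℕ) : ℤ) : RD n) * (tauD n U * psiM U ^ i * psiP U q ^ (m - i)) := by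
  obtain ⟨p, hp⟩ := hU.1
  have h1 : tauD n U * tauD n U = tauD n U * ((-1) * (psiM U + psiP U q)) := by
    linear_combination tauD_sq hn hU hc hp hq hq' + tauD_mul_psiM hn hU hp
  rw [pow_succ', mul_pow_congr h1 m, mul_pow, add_pow, Finset.mul_sum, Finset.mul_sum]
  refine Finset.sum_congr rfl fun i _ => ?_
  push_cast
  ring

theorem TopVal.step (hn : 2 ≤ n) (hU : DAdm n U) (hc : U.card ≤ n - 2) (hT : T ⊂ U) {ρ : ℕ}
    {R : RD n} {v : ℤ} (h : TopVal U ρ R v) (m : ℕ) :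
    TopVal T (ρ + (m + 1)) (tauD n U ^ (m + 1) * R)
      ((-1) ^ m * (Cb m (U.card + m + ρ - n) * Cb (U.card - T.card - 1) (U.card + m + ρ - n)) *
        v) := by
  obtain ⟨q', hqU', hnU', hzero, hval⟩ := h
  obtain ⟨q, hqU, hqT⟩ := Finset.exists_of_ssubset hT
  have hq : q ∈ U \ T := Finset.mem_sdiff.2 ⟨hqU, hqT⟩
  have hcT := Finset.card_lt_card hT
  have hg : (U \ T).card = U.card - T.card := Finset.card_sdiff_of_subset hT.1
  refine ⟨q, hqT, fun h => hU.2.1 q hqU (hT.1 h), fun k hk => ?_, fun k hk => ?_⟩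
  · rw [tauD_pow_eq_sum hn hU hc hqU' hnU', Finset.sum_mul, Finset.mul_sum]
    refine Finset.sum_eq_zero fun i hi => ?_
    rw [Finset.mem_range] at hi
    by_cases hik : (U \ T).card ≤ i + k
    · have := gapD_eq_zero hn hU hT (by omega) hq hik
      linear_combination (((-1) ^ m * (m.choose i : ℕ) : ℤ) : RD n) * psiP U q' ^ (m - i) * R * this
    · have := hzero (m - i) (by omega)
      linear_combination (((-1) ^ m * (m.choose i : ℕ) : ℤ) : RD n) * tauD n T * psiP T q ^ k *
        psiM U ^ i * this
  · rw [tauD_pow_eq_sum hn hU hc hqU' hnU', Finset.sum_mul, Finset.mul_sum]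
    have hz : ∀ i ∈ Finset.range (m + 1), ¬ (i + k + 1 = (U \ T).card) →
        pD T * psiP T q ^ k * ((((-1) ^ m * (m.choose i : ℕ) : ℤ) : RD n) *
          (tauD n U * psiM U ^ i * psiP U q' ^ (m - i)) * R) = 0 := by
      intro i hi hne
      rw [Finset.mem_range] at hi
      rw [pD]
      by_cases hik : (U \ T).card ≤ i + k
      · have := gapD_eq_zero hn hU hT (by omega) hq hik
        linear_combination psiM T ^ (T.card - 1) * (((-1) ^ m * (m.choose i : ℕ) : ℤ) : RD n) *
          psiP U q' ^ (m - i) * R * this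
      · have := hzero (m - i) (by omega)
        linear_combination psiM T ^ (T.card - 1) * (((-1) ^ m * (m.choose i : ℕ) : ℤ) : RD n) *
          tauD n T * psiP T q ^ k * psiM U ^ i * this
    by_cases hcond : ∃ c ∈ Finset.range (m + 1), c + k + 1 = (U \ T).card
    · obtain ⟨c, hcr, hck⟩ := hcond
      rw [Finset.sum_eq_single_of_mem c hcr (fun i hi hic => hz i hi (by omega))]
      rw [Finset.mem_range] at hcr
      have h1 := gapD_eq hn hU hT (by omega) hq hck
      have h2 := hval (m - c) (by omega)
      have e1 : (U.card + m + ρ - n : ℤ) = c := by omega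
      have e2 : (U.card - T.card - 1 : ℤ) = ((U.card - T.card - 1 : ℕ) : ℤ) := by omega
      rw [e1, e2, Cb, Cb, if_pos (by omega), if_pos (by omega)]
      simp only [Int.toNat_natCast]
      rw [hg] at h1
      push_cast
      linear_combination (-1) ^ m * (m.choose c : RD n) * psiP U q' ^ (m - c) * R * h1 +
        (-1) ^ m * (m.choose c : RD n) * ((U.card - T.card - 1).choose c : RD n) * h2
    · push Not at hcond
      rw [Finset.sum_eq_zero fun i hi => hz i hi (hcond i hi)]
      have : Cb m (U.card + m + ρ - n) = 0 := by
        rw [Cb, if_neg]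
        rintro ⟨h1, h2⟩
        obtain ⟨c, hc⟩ := Int.eq_ofNat_of_zero_le h1
        exact hcond c (Finset.mem_range.2 (by omega)) (by omega)
      rw [this]
      simp

end Step

section Corners

variable {n : ℕ} {lam : ℕ → ℕ}

theorem lamE_of_le {i : ℕ} (hi : i ≤ n) : lamE n lam i = lam i := if_pos hi

theorem lamE_of_lt {i : ℕ} (hi : n < i) : lamE n lam i = 0 := if_neg (by omega)

theorem mem_cornerL {i : ℕ} :
    i ∈ cornerL n lam ↔ (1 ≤ i ∧ i ≤ n) ∧ lamE n lam (i + 1) < lamE n lam i := by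
  rw [cornerL, Finset.mem_sort, Finset.mem_filter, Finset.mem_Icc]

theorem iC_zero : iC n lam 0 = 0 := if_pos rfl

theorem iC_succ_of_lt {r : ℕ} (hr : r < sC n lam) : iC n lam (r + 1) = (cornerL n lam)[r] := by
  rw [iC, if_neg (Nat.succ_ne_zero r), Nat.add_sub_cancel, List.getD_eq_getElem _ _ hr]

theorem iC_sC_succ : iC n lam (sC n lam + 1) = n + 1 := by
  rw [iC, if_neg (Nat.succ_ne_zero _), Nat.add_sub_cancel]
  exact List.getD_eq_default _ _ le_rfl

theorem iC_succ_mem {r : ℕ} (hr : r < sC n lam) : iC n lam (r + 1) ∈ cornerL n lam := by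
  rw [iC_succ_of_lt hr]
  exact List.getElem_mem _

theorem cornerL_strictMono : StrictMono (cornerL n lam).get :=
  (Finset.sortedLT_sort _).strictMono_get

theorem iC_lt_iC_succ {r : ℕ} (hr : r < sC n lam) : iC n lam r < iC n lam (r + 1) := by
  rcases r with _ | r
  · have := (mem_cornerL.1 (iC_succ_mem hr)).1.1
    rw [iC_zero]
    omega
  · rw [iC_succ_of_lt hr, iC_succ_of_lt (by omega : r < sC n lam)]
    exact cornerL_strictMono (a := ⟨r, by rw [sC] at hr; omega⟩) (b := ⟨r + 1, hr⟩)
      (Fin.mk_lt_mk.2 (Nat.lt_succ_self r))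

theorem iC_succ_le_of_mem {r i : ℕ} (hr : r < sC n lam) (hi : i ∈ cornerL n lam)
    (h : iC n lam r < i) : iC n lam (r + 1) ≤ i := by
  obtain ⟨j, hj, rfl⟩ := List.getElem_of_mem hi
  rw [iC_succ_of_lt hr]
  have hrj : r ≤ j := by
    by_contra! hjr
    obtain ⟨r, rfl⟩ : ∃ k, r = k + 1 := ⟨r - 1, by omega⟩
    rw [iC_succ_of_lt (by omega : r < sC n lam)] at h
    have := cornerL_strictMono.monotone (a := ⟨j, hj⟩) (b := ⟨r, by rw [sC] at hr; omega⟩)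
      (Fin.mk_le_mk.2 (by omega))
    simp only [List.get_eq_getElem] at this
    omega
  exact cornerL_strictMono.monotone (a := ⟨r, hr⟩) (b := ⟨j, hj⟩) (Fin.mk_le_mk.2 hrj)

theorem iC_le {r : ℕ} (hr : r ≤ sC n lam) : iC n lam r ≤ n := by
  rcases r with _ | r
  · rw [iC_zero]
    exact Nat.zero_le n
  · exact (mem_cornerL.1 (iC_succ_mem hr)).1.2

theorem sC_pos_and_iC_sC (hn : 1 ≤ n) (hpos : ∀ i, 1 ≤ i → i ≤ n → 1 ≤ lam i) :
    1 ≤ sC n lam ∧ iC n lam (sC n lam) = n := by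
  have hmem : n ∈ cornerL n lam := by
    rw [mem_cornerL, lamE_of_lt (Nat.lt_succ_self n), lamE_of_le le_rfl]
    exact ⟨⟨hn, le_rfl⟩, hpos n hn le_rfl⟩
  have hs : 1 ≤ sC n lam := List.length_pos_of_mem hmem
  refine ⟨hs, le_antisymm (iC_le le_rfl) ?_⟩
  by_contra! hlt
  have hle : ∀ r, r ≤ sC n lam → iC n lam r < n := by
    intro r hr
    obtain ⟨d, hd⟩ : ∃ d, r + d = sC n lam := ⟨sC n lam - r, by omega⟩
    induction d generalizing r with
    | zero => rw [show r = sC n lam by omega]; exact hlt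
    | succ d ih => exact (iC_lt_iC_succ (by omega)).trans (ih (r + 1) (by omega) (by omega))
  obtain ⟨j, hj, hjn⟩ := List.getElem_of_mem hmem
  have := hle (j + 1) hj
  rw [iC_succ_of_lt hj] at this
  omega

theorem lam_eq_of_block (hanti : ∀ i j, 1 ≤ i → i ≤ j → j ≤ n → lam j ≤ lam i) {r i : ℕ}
    (hr : r < sC n lam) (hi : iC n lam r < i) (hi' : i ≤ iC n lam (r + 1)) :
    lam i = lam (iC n lam (r + 1)) := by
  have hn := iC_le (n := n) (lam := lam) (r := r + 1) hr
  obtain ⟨d, hd⟩ : ∃ d, i + d = iC n lam (r + 1) := ⟨iC n lam (r + 1) - i, by omega⟩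
  induction d generalizing i with
  | zero => rw [← hd, add_zero]
  | succ d ih =>
    rw [← ih (i := i + 1) (by omega) (by omega) (by omega)]
    refine le_antisymm ?_ (hanti _ _ (by omega) (by omega) (by omega))
    by_contra! hlt
    have := iC_succ_le_of_mem hr (mem_cornerL.2 ⟨⟨by omega, by omega⟩, by
      rwa [lamE_of_le (by omega), lamE_of_le (by omega)]⟩) hi
    omega

theorem lamE_iC_lt (hanti : ∀ i j, 1 ≤ i → i ≤ j → j ≤ n → lam j ≤ lam i) {r : ℕ} (h1 : 1 ≤ r)
    (hr : r ≤ sC n lam) : lamE n lam (iC n lam (r + 1)) < lamE n lam (iC n lam r) := by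
  obtain ⟨r, rfl⟩ : ∃ k, r = k + 1 := ⟨r - 1, by omega⟩
  have hm := (mem_cornerL.1 (iC_succ_mem hr))
  refine lt_of_le_of_lt ?_ hm.2
  rcases hr.lt_or_eq with hr | hr
  · have h2 := iC_lt_iC_succ hr
    have h3 := iC_le (n := n) (lam := lam) (r := r + 1 + 1) hr
    rw [lamE_of_le h3, lamE_of_le (by omega)]
    exact hanti _ _ (by omega) h2 h3
  · rw [hr, iC_sC_succ, lamE_of_lt (Nat.lt_succ_self n)]
    exact Nat.zero_le _

end Corners

section Parity

variable {n : ℕ} {r : PM n} {S F : Finset (PM n)}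

theorem even_negCount_flipD (hF : DAdm n F) (hr : r ∈ F) :
    Even (negCount (flipD F r)) ↔ ¬ Even (negCount F) := by
  have hneg := hF.2.1 r hr
  rw [negCount, negCount, flipD, Finset.filter_insert, Finset.filter_erase]
  cases h : r.2
  · have hm : r ∈ F.filter (fun p => p.2 = false) := Finset.mem_filter.2 ⟨hr, h⟩
    rw [if_neg (by simp [negPM, h]), Finset.card_erase_of_mem hm]
    have := Finset.card_pos.2 ⟨r, hm⟩
    rw [Nat.even_sub (by omega)]
    simp
  · rw [if_pos (by simp [negPM, h]), Finset.card_insert_of_notMem (by simp [hneg]),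
      Finset.erase_eq_of_notMem (by simp [h]), Nat.even_add_one]

theorem eq_or_eq_flipD (hF : DAdm n F) (hc : F.card = n) (hS : DAdm n S) (hSc : S.card = n)
    (h : Compat n S F) : S = F ∨ ∃ r ∈ F, S = flipD F r := by
  rcases h with h | h | h
  · exact Or.inl (Finset.eq_of_subset_of_card_le h (by omega))
  · exact Or.inl (Finset.eq_of_subset_of_card_le h (by omega)).symm
  · obtain ⟨r, hr, -, h⟩ := eq_flipD hF hc hS hSc h.2.2
    exact Or.inr ⟨r, hr, h⟩

theorem eq_of_even_negCount (hF : DAdm n F) (hc : F.card = n) (hS : DAdm n S) (hSc : S.card = n)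
    (h : Compat n S F) (hpar : Even (negCount S) ↔ Even (negCount F)) : S = F := by
  rcases eq_or_eq_flipD hF hc hS hSc h with h | ⟨r, hr, rfl⟩
  · exact h
  · rw [even_negCount_flipD hF hr] at hpar
    tauto

theorem subset_of_compat (h : Compat n S F) (hS : S.card ≠ n) (hle : S.card ≤ F.card) : S ⊆ F := by
  rcases h with h | h | h
  · exact h
  · exact (Finset.eq_of_subset_of_card_le h hle).symm.subset
  · exact absurd h.1 hS

end Parity

section Subchain

variable {n : ℕ} {S : ℕ → Finset (PM n)} {r i : ℕ}

/-- A weakly increasing sequence of `n` pairwise compatible admissible sets. -/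
structure IsSubchain (n : ℕ) (S : ℕ → Finset (PM n)) : Prop where
  adm : ∀ i ∈ Finset.Icc 1 n, DAdm n (S i)
  comp : ∀ i ∈ Finset.Icc 1 n, ∀ j ∈ Finset.Icc 1 n, Compat n (S i) (S j)
  mono : ∀ i j, 1 ≤ i → i ≤ j → j ≤ n → (S i).card ≤ (S j).card

/-- The row lengths of the diagram of a subchain. -/
def rowLam (n : ℕ) (S : ℕ → Finset (PM n)) (i : ℕ) : ℕ := (S (n + 1 - i)).card

/-- The set of a subchain at the `r`-th corner, and the empty set beyond the last corner. -/
def cornerSet (n : ℕ) (S : ℕ → Finset (PM n)) (r : ℕ) : Finset (PM n) :=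
  if r ≤ sC n (rowLam n S) then S (n + 1 - iC n (rowLam n S) r) else ∅

theorem Cb_natCast (x y : ℕ) : Cb x y = x.choose y := by
  rw [Cb]
  split_ifs with h
  · simp
  · rw [Nat.choose_eq_zero_of_lt (by omega), Nat.cast_zero]

theorem IsSubchain.anti (h : IsSubchain n S) :
    ∀ i j, 1 ≤ i → i ≤ j → j ≤ n → rowLam n S j ≤ rowLam n S i :=
  fun i j h1 h2 h3 => h.mono _ _ (by omega) (by omega) (by omega)

theorem IsSubchain.rowLam_pos (h : IsSubchain n S) : ∀ i, 1 ≤ i → i ≤ n → 1 ≤ rowLam n S i :=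
  fun i h1 h2 => Finset.card_pos.2 (h.adm _ (Finset.mem_Icc.2 (by omega))).1

theorem IsSubchain.sC_pos (h : IsSubchain n S) (hn : 2 ≤ n) : 1 ≤ sC n (rowLam n S) :=
  (sC_pos_and_iC_sC (by omega) h.rowLam_pos).1

theorem reflect_iC_mem (h1 : 1 ≤ r) (hr : r ≤ sC n (rowLam n S)) :
    n + 1 - iC n (rowLam n S) r ∈ Finset.Icc 1 n := by
  obtain ⟨r, rfl⟩ : ∃ k, r = k + 1 := ⟨r - 1, by omega⟩
  have := (mem_cornerL.1 (iC_succ_mem hr)).1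
  rw [Finset.mem_Icc]
  omega

theorem cornerSet_of_le (hr : r ≤ sC n (rowLam n S)) :
    cornerSet n S r = S (n + 1 - iC n (rowLam n S) r) := if_pos hr

theorem card_cornerSet (h1 : 1 ≤ r) (hr : r ≤ sC n (rowLam n S) + 1) :
    (cornerSet n S r).card = lamE n (rowLam n S) (iC n (rowLam n S) r) := by
  rcases hr.lt_or_eq with hr | rfl
  · rw [cornerSet_of_le (by omega), lamE_of_le (iC_le (by omega)), rowLam]
  · rw [cornerSet, if_neg (by omega), iC_sC_succ, lamE_of_lt (Nat.lt_succ_self n),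
      Finset.card_empty]

theorem IsSubchain.dAdm_cornerSet (h : IsSubchain n S) (h1 : 1 ≤ r)
    (hr : r ≤ sC n (rowLam n S)) : DAdm n (cornerSet n S r) := by
  rw [cornerSet_of_le hr]
  exact h.adm _ (reflect_iC_mem h1 hr)

theorem IsSubchain.card_cornerSet_lt (h : IsSubchain n S) (h1 : 1 ≤ r)
    (hr : r ≤ sC n (rowLam n S)) : (cornerSet n S (r + 1)).card < (cornerSet n S r).card := by
  rw [card_cornerSet h1 (by omega), card_cornerSet (by omega) (by omega)]
  exact lamE_iC_lt h.anti h1 hr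

theorem IsSubchain.cornerSet_ssubset (h : IsSubchain n S) (h1 : 1 ≤ r)
    (hr : r ≤ sC n (rowLam n S)) : cornerSet n S (r + 1) ⊂ cornerSet n S r := by
  have hlt := h.card_cornerSet_lt h1 hr
  have hle := (h.dAdm_cornerSet h1 hr).card_le
  have hsub : cornerSet n S (r + 1) ⊆ cornerSet n S r := by
    rcases hr.lt_or_eq with hr' | hr'
    · refine subset_of_compat ?_ (by omega) hlt.le
      rw [cornerSet_of_le hr, cornerSet_of_le hr']
      exact h.comp _ (reflect_iC_mem (by omega) hr') _ (reflect_iC_mem h1 hr)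
    · rw [cornerSet, if_neg (by omega)]
      exact Finset.empty_subset _
  exact Finset.ssubset_iff_subset_ne.2 ⟨hsub, fun he => by rw [he] at hlt; exact hlt.false⟩

theorem IsSubchain.card_cornerSet_succ_le (h : IsSubchain n S) (h1 : 1 ≤ r)
    (hr : r ≤ sC n (rowLam n S)) : (cornerSet n S (r + 1)).card ≤ n - 2 := by
  have hlt := h.card_cornerSet_lt h1 hr
  have hle := (h.dAdm_cornerSet h1 hr).card_le
  rcases hr.lt_or_eq with hr' | hr'
  · exact (h.dAdm_cornerSet (r := r + 1) (by omega) hr').card_le_of_ne (by omega)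
  · rw [cornerSet, if_neg (by omega), Finset.card_empty]
    exact Nat.zero_le _

theorem IsSubchain.row_eq_cornerSet (h : IsSubchain n S) (hr : r < sC n (rowLam n S))
    (hi : iC n (rowLam n S) r < i) (hi' : i ≤ iC n (rowLam n S) (r + 1))
    (hc : (cornerSet n S (r + 1)).card ≠ n) : S (n + 1 - i) = cornerSet n S (r + 1) := by
  have hn := iC_le (n := n) (lam := rowLam n S) (r := r + 1) hr
  have he := lam_eq_of_block h.anti hr hi hi'
  rw [cornerSet_of_le (r := r + 1) hr] at hc ⊢
  rw [rowLam, rowLam] at he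
  have hcomp := h.comp (n + 1 - i) (Finset.mem_Icc.2 (by omega)) _
    (reflect_iC_mem (r := r + 1) (by omega) hr)
  exact Finset.eq_of_subset_of_card_le (subset_of_compat hcomp (by omega) he.le) he.ge

theorem IsSubchain.prod_block (h : IsSubchain n S) (hr : r < sC n (rowLam n S))
    (hc : (cornerSet n S (r + 1)).card ≠ n) :
    ∏ i ∈ Finset.Icc 1 (iC n (rowLam n S) (r + 1)), tauD n (S (n + 1 - i)) =
      tauD n (cornerSet n S (r + 1)) ^
          (iC n (rowLam n S) (r + 1) - iC n (rowLam n S) r - 1 + 1) *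
        ∏ i ∈ Finset.Icc 1 (iC n (rowLam n S) r), tauD n (S (n + 1 - i)) := by
  have hlt := iC_lt_iC_succ hr
  have hunion : Finset.Icc 1 (iC n (rowLam n S) (r + 1)) =
      Finset.Ioc (iC n (rowLam n S) r) (iC n (rowLam n S) (r + 1)) ∪
        Finset.Icc 1 (iC n (rowLam n S) r) := by
    ext i
    simp only [Finset.mem_union, Finset.mem_Icc, Finset.mem_Ioc]
    omega
  have hdisj : Disjoint (Finset.Ioc (iC n (rowLam n S) r) (iC n (rowLam n S) (r + 1)))
      (Finset.Icc 1 (iC n (rowLam n S) r)) := by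
    rw [Finset.disjoint_left]
    intro i
    simp only [Finset.mem_Icc, Finset.mem_Ioc]
    omega
  rw [hunion, Finset.prod_union hdisj]
  congr 1
  rw [Finset.prod_congr rfl fun i hi => by
    rw [h.row_eq_cornerSet hr (Finset.mem_Ioc.1 hi).1 (Finset.mem_Ioc.1 hi).2 hc],
    Finset.prod_const, Nat.card_Ioc]
  congr 1
  omega

theorem IsSubchain.topVal_succ (h : IsSubchain n S) (hn : 2 ≤ n) (h1 : 1 ≤ r)
    (hr : r < sC n (rowLam n S)) {v : ℤ}
    (hv : TopVal (cornerSet n S (r + 1)) (iC n (rowLam n S) r)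
      (∏ i ∈ Finset.Icc 1 (iC n (rowLam n S) r), tauD n (S (n + 1 - i))) v) :
    TopVal (cornerSet n S (r + 2)) (iC n (rowLam n S) (r + 1))
      (∏ i ∈ Finset.Icc 1 (iC n (rowLam n S) (r + 1)), tauD n (S (n + 1 - i)))
      ((-1) ^ (iC n (rowLam n S) (r + 1) - iC n (rowLam n S) r - 1) *
        yC n (rowLam n S) (r + 1) * v) := by
  have hlt := iC_lt_iC_succ hr
  have hc := h.card_cornerSet_succ_le h1 hr.le
  have key := hv.step hn (h.dAdm_cornerSet (r := r + 1) (by omega) hr) hc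
    (h.cornerSet_ssubset (r := r + 1) (by omega) hr)
    (iC n (rowLam n S) (r + 1) - iC n (rowLam n S) r - 1)
  rw [← h.prod_block hr (by omega)] at key
  convert key using 1
  · omega
  · rw [yC, aC, bC, cC, ← card_cornerSet (by omega) (by omega), Nat.add_sub_cancel,
      ← card_cornerSet (by omega) (by omega)]
    congr 3 <;> congr 1 <;> omega

end Subchain

section FullRows

variable {n : ℕ} {S : ℕ → Finset (PM n)} {J : Finset ℕ} {T : Finset (PM n)}

theorem two_pow_choose_identity {g : ℕ} (hg : 2 ≤ g) (m : ℕ) :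
    (-2) ^ (m + 1) * ((g - 1).choose (m + 1) : ℤ) + g * ((-1) ^ m * ((g - 2).choose m : ℤ)) =
      (-1) ^ (m + 1) * ((2 ^ (m + 1) - (m + 1) - 1) * ((g - 1).choose (m + 1) : ℤ) +
        ((g - 2).choose (m + 1) : ℤ)) := by
  obtain ⟨d, rfl⟩ : ∃ d, g = d + 2 := ⟨g - 2, by omega⟩
  have h1 : ((d + 1 : ℕ) : ℤ) * (d.choose m : ℤ) = ((d + 1).choose (m + 1) : ℤ) * (m + 1 : ℕ) := by
    exact_mod_cast Nat.add_one_mul_choose_eq d m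
  have h2 : ((d + 1).choose (m + 1) : ℤ) = d.choose m + d.choose (m + 1) := by
    exact_mod_cast Nat.choose_succ_succ d m
  rw [show d + 2 - 1 = d + 1 by omega, show d + 2 - 2 = d by omega,
    show (-2 : ℤ) = (-1) * 2 by norm_num, mul_pow]
  push_cast at h1 ⊢
  rw [pow_succ (-1 : ℤ) m]
  linear_combination (-1) ^ m * h1 - (-1) ^ m * h2

theorem IsSubchain.topVal_full_rows_same (h : IsSubchain n S) (hn : 2 ≤ n)
    (hJ : J ⊆ Finset.Icc 1 n) (hfull : ∀ i ∈ J, (S i).card = n) (hT : ∀ i ∈ J, T ⊂ S i)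
    (hcT : T.card ≤ n - 2) (hm : 2 ≤ J.card)
    (hpar : ∀ i ∈ J, ∀ j ∈ J, (Even (negCount (S i)) ↔ Even (negCount (S j)))) :
    TopVal T J.card (∏ i ∈ J, tauD n (S i))
      ((-1) ^ (J.card - 1) * ((2 ^ (J.card - 1) - (J.card - 1 : ℕ) - 1) *
        ((n - T.card - 1).choose (J.card - 1) : ℤ) +
          ((n - T.card - 2).choose (J.card - 1) : ℤ))) := by
  obtain ⟨j, hj⟩ := Finset.card_pos.1 (by omega : 0 < J.card)
  have heq : ∀ i ∈ J, S i = S j := fun i hi =>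
    eq_of_even_negCount (h.adm j (hJ hj)) (hfull j hj) (h.adm i (hJ hi)) (hfull i hi)
      (h.comp i (hJ hi) j (hJ hj)) (hpar i hi j hj)
  rw [Finset.prod_congr rfl fun i hi => by rw [heq i hi], Finset.prod_const]
  have key := topVal_same hn (h.adm j (hJ hj)) (hfull j hj) (hT j hj) hcT (J.card - 2)
  obtain ⟨m, hm⟩ : ∃ m, J.card = m + 2 := ⟨J.card - 2, by omega⟩
  rw [hm, Nat.add_sub_cancel] at key
  rw [hm, show m + 2 - 1 = m + 1 by omega]
  convert key using 1
  rw [two_pow_choose_identity (by omega)]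
  push_cast
  rfl

theorem IsSubchain.topVal_full_rows_opposite (h : IsSubchain n S) (hn : 2 ≤ n)
    (hJ : J ⊆ Finset.Icc 1 n) (hfull : ∀ i ∈ J, (S i).card = n) (hT : ∀ i ∈ J, T ⊂ S i)
    (hcT : T.card ≤ n - 2) (hP : (J.filter fun i => Even (negCount (S i))).Nonempty)
    (hM : (J.filter fun i => ¬ Even (negCount (S i))).Nonempty) :
    TopVal T J.card (∏ i ∈ J, tauD n (S i))
      ((-1) ^ J.card * ((n - T.card - 2).choose (J.card - 2) : ℤ)) := by
  obtain ⟨j, hj⟩ := hP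
  obtain ⟨l, hl⟩ := hM
  have hcardP := Finset.card_pos.2 ⟨j, hj⟩
  have hcardM := Finset.card_pos.2 ⟨l, hl⟩
  have hcard := Finset.card_filter_add_card_filter_not (s := J) fun i => Even (negCount (S i))
  have hsame : ∀ i ∈ J, ∀ k ∈ J, (Even (negCount (S i)) ↔ Even (negCount (S k))) → S i = S k :=
    fun i hi k hk => eq_of_even_negCount (h.adm k (hJ hk)) (hfull k hk) (h.adm i (hJ hi))
      (hfull i hi) (h.comp i (hJ hi) k (hJ hk))
  rw [← Finset.prod_filter_mul_prod_filter_not J fun i => Even (negCount (S i))]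
  rw [Finset.mem_filter] at hj hl
  have hprodP : ∏ i ∈ J.filter (fun i => Even (negCount (S i))), tauD n (S i) =
      tauD n (S j) ^ (J.filter fun i => Even (negCount (S i))).card := by
    rw [← Finset.prod_const]
    refine Finset.prod_congr rfl fun i hi => ?_
    rw [Finset.mem_filter] at hi
    rw [hsame i hi.1 j hj.1 (by tauto)]
  have hprodM : ∏ i ∈ J.filter (fun i => ¬ Even (negCount (S i))), tauD n (S i) =
      tauD n (S l) ^ (J.filter fun i => ¬ Even (negCount (S i))).card := by
    rw [← Finset.prod_const]
    refine Finset.prod_congr rfl fun i hi => ?_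
    rw [Finset.mem_filter] at hi
    rw [hsame i hi.1 l hl.1 (by tauto)]
  obtain ⟨r, hr, hlr⟩ := (eq_or_eq_flipD (h.adm j (hJ hj.1)) (hfull j hj.1) (h.adm l (hJ hl.1))
    (hfull l hl.1) (h.comp l (hJ hl.1) j (hJ hj.1))).resolve_left
      fun he => hl.2 (he ▸ hj.2)
  have hrT : r ∉ T := fun hrT => by
    have hmem := (hT l hl.1).1 hrT
    have hneg : negPM r ∈ S l := by
      rw [hlr, flipD]
      exact Finset.mem_insert_self _ _
    exact (h.adm l (hJ hl.1)).2.1 r hmem hneg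
  have key := topVal_opposite hn (h.adm j (hJ hj.1)) (hfull j hj.1) hr (hT j hj.1) hcT hrT
    ((J.filter fun i => Even (negCount (S i))).card - 1)
    ((J.filter fun i => ¬ Even (negCount (S i))).card - 1)
  rw [Nat.sub_add_cancel hcardP, Nat.sub_add_cancel hcardM, ← hlr, ← hprodP, ← hprodM,
    show (J.filter fun i => Even (negCount (S i))).card - 1 +
      ((J.filter fun i => ¬ Even (negCount (S i))).card - 1) = J.card - 2 by omega,
    show J.card - 2 + 2 = J.card by omega] at key
  convert key using 2
  obtain ⟨m, hm⟩ : ∃ m, J.card = m + 2 := ⟨J.card - 2, by omega⟩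
  rw [hm, Nat.add_sub_cancel, pow_add]
  norm_num

end FullRows

section Assembly

variable {n : ℕ} {S : ℕ → Finset (PM n)} {r : ℕ}

theorem IsSubchain.filter_full (h : IsSubchain n S) (hn : 2 ≤ n) (hl : rowLam n S 1 = n) :
    (Finset.Icc 1 n).filter (fun i => (S i).card = n) =
      (Finset.Icc 1 (iC n (rowLam n S) 1)).image fun i => n + 1 - i := by
  have hs := h.sC_pos hn
  have hi := iC_le hs
  have h0 := iC_lt_iC_succ (n := n) (lam := rowLam n S) (r := 0) hs
  rw [iC_zero, zero_add] at h0
  have hblock : ∀ i, 1 ≤ i → i ≤ iC n (rowLam n S) 1 → rowLam n S i = n := fun i h1 h2 => by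
    rw [lam_eq_of_block (r := 0) h.anti hs (by rw [iC_zero]; omega) h2]
    exact (lam_eq_of_block (r := 0) h.anti hs (by rw [iC_zero]; omega) h0).symm.trans hl
  have hlt := lamE_iC_lt h.anti le_rfl hs
  rw [lamE_of_le hi, hblock _ h0 le_rfl] at hlt
  ext i
  simp only [Finset.mem_filter, Finset.mem_image, Finset.mem_Icc]
  constructor
  · rintro ⟨⟨h1, h2⟩, hc⟩
    refine ⟨n + 1 - i, ⟨by omega, ?_⟩, by omega⟩
    by_contra! hgt
    have hmem := (mem_cornerL.1 (iC_succ_mem (r := 0) hs)).2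
    have h3 := h.anti (iC n (rowLam n S) 1 + 1) (n + 1 - i) (by omega) hgt (by omega)
    rw [zero_add, lamE_of_le hi, lamE_of_le (by omega), hblock _ h0 le_rfl] at hmem
    rw [rowLam, show n + 1 - (n + 1 - i) = i by omega, hc] at h3
    omega
  · rintro ⟨k, ⟨h1, h2⟩, rfl⟩
    exact ⟨by omega, hblock k h1 h2⟩

theorem IsSubchain.topVal_first (h : IsSubchain n S) (hn : 2 ≤ n) :
    TopVal (cornerSet n S 2) (iC n (rowLam n S) 1)
      (∏ i ∈ Finset.Icc 1 (iC n (rowLam n S) 1), tauD n (S (n + 1 - i)))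
      ((-1) ^ (iC n (rowLam n S) 1 - 1) * tyOne n (rowLam n S)
        ((Finset.Icc 1 n).filter (fun i => (S i).card = n)).card
        ((Finset.Icc 1 n).filter (fun i => (S i).card = n ∧ Even (negCount (S i)))).card
        ((Finset.Icc 1 n).filter (fun i => (S i).card = n ∧ ¬ Even (negCount (S i)))).card) := by
  have hs := h.sC_pos hn
  have hi := iC_le hs
  have h0 := iC_lt_iC_succ (n := n) (lam := rowLam n S) (r := 0) hs
  rw [iC_zero, zero_add] at h0
  have hl1 : rowLam n S 1 = rowLam n S (iC n (rowLam n S) 1) :=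
    lam_eq_of_block (r := 0) h.anti hs (by rw [iC_zero]; omega) h0
  have hc1 := card_cornerSet (n := n) (S := S) le_rfl (by omega : 1 ≤ sC n (rowLam n S) + 1)
  have hc2 := card_cornerSet (n := n) (S := S) (r := 2) (by omega)
    (by omega : 2 ≤ sC n (rowLam n S) + 1)
  have hcT : (cornerSet n S 2).card ≤ n - 2 := h.card_cornerSet_succ_le le_rfl hs
  have hsub : cornerSet n S 2 ⊂ cornerSet n S 1 := h.cornerSet_ssubset le_rfl hs
  have hadm := h.dAdm_cornerSet le_rfl hs
  have hle := hadm.card_le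
  have hb : bC n (rowLam n S) 1 = (cornerSet n S 1).card - (cornerSet n S 2).card - 1 := by
    rw [bC, hc1, hc2]
  have hc : cC n (rowLam n S) 1 = (cornerSet n S 1).card + iC n (rowLam n S) 1 - n - 1 := by
    rw [cC, hc1]
  have ha : aC n (rowLam n S) 1 = iC n (rowLam n S) 1 - 1 := by
    rw [aC, Nat.sub_self, iC_zero]
    push_cast
    ring
  have hl1' : rowLam n S 1 = (cornerSet n S 1).card := by rw [hc1, lamE_of_le hi, hl1]
  by_cases hfull : (cornerSet n S 1).card = n
  · have hl : rowLam n S 1 = n := by rw [hl1', hfull]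
    have hinj : Set.InjOn (fun i => n + 1 - i) (Finset.Icc 1 (iC n (rowLam n S) 1)) := by
      intro x hx y hy hxy
      simp only [Finset.coe_Icc, Set.mem_Icc] at hx hy hxy
      omega
    have hJc : ((Finset.Icc 1 n).filter (fun i => (S i).card = n)).card =
        iC n (rowLam n S) 1 := by
      rw [h.filter_full hn hl, Finset.card_image_of_injOn hinj, Nat.card_Icc, Nat.add_sub_cancel]
    have hprod : ∏ i ∈ Finset.Icc 1 (iC n (rowLam n S) 1), tauD n (S (n + 1 - i)) =
        ∏ i ∈ (Finset.Icc 1 n).filter (fun i => (S i).card = n), tauD n (S i) := by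
      rw [h.filter_full hn hl, Finset.prod_image hinj]
    have hPM := Finset.card_filter_add_card_filter_not
      (s := (Finset.Icc 1 n).filter (fun i => (S i).card = n)) fun i => Even (negCount (S i))
    rw [← Finset.filter_filter, ← Finset.filter_filter, hprod, ← hJc]
    rw [← hJc] at ha hc h0
    rw [hfull] at hb hc
    set J := (Finset.Icc 1 n).filter (fun i => (S i).card = n) with hJ
    have hJn : J ⊆ Finset.Icc 1 n := Finset.filter_subset _ _
    have hJf : ∀ i ∈ J, (S i).card = n := fun i hi => (Finset.mem_filter.1 hi).2
    have hJT : ∀ i ∈ J, cornerSet n S 2 ⊂ S i := fun i hi => by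
      have hci := hJf i hi
      refine Finset.ssubset_iff_subset_ne.2 ⟨?_, fun he => by rw [he] at hcT; omega⟩
      rw [cornerSet]
      split_ifs with h2
      · refine subset_of_compat (h.comp _ (reflect_iC_mem (by omega) h2) i (hJn hi)) ?_ ?_
        · rw [← cornerSet_of_le h2]
          omega
        · rw [← cornerSet_of_le h2]
          omega
      · exact Finset.empty_subset _
    have hb' : bC n (rowLam n S) 1 = ((n - (cornerSet n S 2).card - 1 : ℕ) : ℤ) := by omega
    have hb2 : bC n (rowLam n S) 1 - 1 = ((n - (cornerSet n S 2).card - 2 : ℕ) : ℤ) := by omega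
    have hc' : cC n (rowLam n S) 1 = ((J.card - 1 : ℕ) : ℤ) := by omega
    have ha' : aC n (rowLam n S) 1 = ((J.card - 1 : ℕ) : ℤ) := by omega
    rw [tyOne]
    split_ifs with h1 hpm
    · obtain ⟨j, hj⟩ := Finset.card_eq_one.1 (by omega : J.card = 1)
      have hjJ : j ∈ J := by simp [hj]
      have key := topVal_one hn (h.adm j (hJn hjJ)) (hJf j hjJ) (hJT j hjJ) hcT
      rw [ha', hb', hc', Cb_natCast, Cb_natCast, hj]
      simpa using key
    · have key := h.topVal_full_rows_opposite hn hJn hJf hJT hcT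
        (Finset.card_pos.1 (Nat.pos_of_ne_zero hpm.1))
        (Finset.card_pos.1 (Nat.pos_of_ne_zero hpm.2))
      convert key using 1
      rw [hb2, show cC n (rowLam n S) 1 - 1 = ((J.card - 2 : ℕ) : ℤ) by omega, Cb_natCast]
      obtain ⟨m, hm⟩ : ∃ m, J.card = m + 1 := ⟨J.card - 1, by omega⟩
      rw [hm, Nat.add_sub_cancel, pow_succ]
      ring
    · have key := h.topVal_full_rows_same hn hJn hJf hJT hcT (by omega) (by
        intro i hi j hj
        by_contra hne
        apply hpm
        rw [← Nat.pos_iff_ne_zero, ← Nat.pos_iff_ne_zero, Finset.card_pos, Finset.card_pos]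
        by_cases hev : Even (negCount (S i))
        · exact ⟨⟨i, Finset.mem_filter.2 ⟨hi, hev⟩⟩, ⟨j, Finset.mem_filter.2 ⟨hj, by tauto⟩⟩⟩
        · exact ⟨⟨j, Finset.mem_filter.2 ⟨hj, by tauto⟩⟩, ⟨i, Finset.mem_filter.2 ⟨hi, hev⟩⟩⟩)
      convert key using 2
      rw [hb2, hb', hc', ha', Cb_natCast, Cb_natCast, Int.toNat_natCast]
  · have hc1' := hadm.card_le_of_ne hfull
    have hempty : (Finset.Icc 1 n).filter (fun i => (S i).card = n) = ∅ := by
      refine Finset.filter_eq_empty_iff.2 fun i hi he => ?_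
      rw [Finset.mem_Icc] at hi
      have := h.mono i n hi.1 hi.2 le_rfl
      rw [rowLam, Nat.add_sub_cancel] at hl1'
      omega
    have key := (topVal_empty_product hn hadm hc1').step hn hadm hc1' hsub
      (iC n (rowLam n S) 1 - 1)
    have hblock := h.prod_block (r := 0) hs (by simpa using hfull)
    rw [iC_zero, zero_add, Nat.sub_zero] at hblock
    rw [hblock, hempty, Finset.card_empty, tyOne, if_pos (Nat.zero_le 1), ha, hb, hc, hl1',
      Nat.sub_zero, mul_one]
    convert key using 1
    · omega
    · simp
    · rw [show ((iC n (rowLam n S) 1 : ℕ) : ℤ) - 1 = ((iC n (rowLam n S) 1 - 1 : ℕ) : ℤ) by omega,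
        show (((cornerSet n S 1).card : ℤ) + ((iC n (rowLam n S) 1 - 1 : ℕ) : ℤ) + (0 : ℕ) - n) =
          (cornerSet n S 1).card + iC n (rowLam n S) 1 - n - 1 by omega]
      ring

theorem IsSubchain.topVal_corner (h : IsSubchain n S) (hn : 2 ≤ n) {v : ℤ}
    (hv : TopVal (cornerSet n S 2) (iC n (rowLam n S) 1)
      (∏ i ∈ Finset.Icc 1 (iC n (rowLam n S) 1), tauD n (S (n + 1 - i)))
      ((-1) ^ (iC n (rowLam n S) 1 - 1) * v)) (h1 : 1 ≤ r) (hr : r ≤ sC n (rowLam n S)) :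
    TopVal (cornerSet n S (r + 1)) (iC n (rowLam n S) r)
      (∏ i ∈ Finset.Icc 1 (iC n (rowLam n S) r), tauD n (S (n + 1 - i)))
      ((-1) ^ (iC n (rowLam n S) r + r) * v * ∏ k ∈ Finset.Icc 2 r, yC n (rowLam n S) k) := by
  induction r, h1 using Nat.le_induction with
  | base =>
    have h0 := iC_lt_iC_succ (n := n) (lam := rowLam n S) (r := 0) hr
    rw [iC_zero, zero_add] at h0
    convert hv using 1
    obtain ⟨m, hm⟩ : ∃ m, iC n (rowLam n S) 1 = m + 1 := ⟨iC n (rowLam n S) 1 - 1, by omega⟩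
    rw [hm, Nat.add_sub_cancel, pow_succ, pow_succ]
    simp
  | succ r h1 ih =>
    have hlt := iC_lt_iC_succ (n := n) (lam := rowLam n S) (r := r) hr
    convert h.topVal_succ hn h1 hr (ih (by omega)) using 1
    obtain ⟨d, hd⟩ : ∃ d, iC n (rowLam n S) (r + 1) = iC n (rowLam n S) r + d + 1 :=
      ⟨iC n (rowLam n S) (r + 1) - iC n (rowLam n S) r - 1, by omega⟩
    rw [Finset.prod_Icc_succ_top (by omega), hd,
      show iC n (rowLam n S) r + d + 1 - iC n (rowLam n S) r - 1 = d by omega,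
      show iC n (rowLam n S) r + d + 1 + (r + 1) = iC n (rowLam n S) r + r + d + 2 by omega,
      pow_add, pow_add _ (iC n (rowLam n S) r + r)]
    ring

theorem TopVal.prod_eq {R : RD n} {v : ℤ} (h : TopVal ∅ n R v) : R = (v : RD n) * ptD n := by
  obtain ⟨q, -, -, -, h⟩ := h
  have := h 0 (by simp)
  rwa [pD_empty, pow_zero, one_mul, one_mul] at this

end Assembly

/-- For a subchain `S_1, …, S_n` of pairwise compatible D-admissible subsets of
`[±n]` with `|S_1| ≤ … ≤ |S_n|`, letting `λ_i = |S_{n+1−i}|`, `m`, `m_+`, `m_−` as described, one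
has `τ_{S_1} ⋯ τ_{S_n} = (−1)^{n+s} ỹ_1 y_2 ⋯ y_s · τ_{{1}} ⋯ τ_{{1,…,n−2}} τ_{[n]_+} τ_{[n]_−}`
in `R^D_n`. -/
theorem typeD_intersection_formula (n : ℕ) (hn : 2 ≤ n)
    (S : ℕ → Finset (PM n))
    (hadm : ∀ i ∈ Finset.Icc 1 n, DAdm n (S i))
    (hcomp : ∀ i ∈ Finset.Icc 1 n, ∀ j ∈ Finset.Icc 1 n, Compat n (S i) (S j))
    (hmono : ∀ i j, 1 ≤ i → i ≤ j → j ≤ n → (S i).card ≤ (S j).card) :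
    (∏ i ∈ Finset.Icc 1 n, tauD n (S i)) =
      (((-1) ^ (n + sC n (fun i => (S (n + 1 - i)).card)) *
          tyOne n (fun i => (S (n + 1 - i)).card)
            ((Finset.Icc 1 n).filter (fun i => (S i).card = n)).card
            ((Finset.Icc 1 n).filter (fun i => (S i).card = n ∧ Even (negCount (S i)))).card
            ((Finset.Icc 1 n).filter (fun i => (S i).card = n ∧ ¬ Even (negCount (S i)))).card *
          ∏ r ∈ Finset.Icc 2 (sC n (fun i => (S (n + 1 - i)).card)),
            yC n (fun i => (S (n + 1 - i)).card) r : ℤ) : RD n) * ptD n := by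
  have h : IsSubchain n S := ⟨hadm, hcomp, hmono⟩
  obtain ⟨hs, hi⟩ := sC_pos_and_iC_sC (by omega : 1 ≤ n) h.rowLam_pos
  have key := h.topVal_corner hn (h.topVal_first hn) hs le_rfl
  rw [cornerSet, if_neg (by omega), hi] at key
  refine Eq.trans ?_ key.prod_eq
  refine Finset.prod_nbij' (fun i => n + 1 - i) (fun i => n + 1 - i) ?_ ?_ ?_ ?_ ?_
  · simp only [Finset.mem_Icc]
    omega
  · simp only [Finset.mem_Icc]
    omega
  · simp only [Finset.mem_Icc]
    omega
  · simp only [Finset.mem_Icc]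
    omega
  · intro i hi
    rw [Finset.mem_Icc] at hi
    rw [show n + 1 - (n + 1 - i) = i by omega]
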